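/- Let n ≥ 1 and let k ≥ 0 be an even integer. Let M = (a, b; c, d) ∈ SAV(ℝ⊕ℝ^n), let U ⊆ ℝ^{n+1} be an open set of paravectors x such that cx+d is invertible for every x ∈ U, and let V ⊆ ℝ^{n+1} be an open set containing M<U>. If f : V → Cl_n is smooth with D Δ^{k/2} f = 0 on V, then the function F(x) := (conj(cx+d)/‖cx+d‖^{n+1−k}) · f(M<x>) satisfies D Δ^{k/2} F = 0 on U. -/

import Mathlib

noncomputable section

open scoped symmDiff

/-- An explicit model of the real Clifford algebra `Cl_n` with generators `e 0, …, e (n-1)`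
satisfying `eᵢ eⱼ + eⱼ eᵢ = -2 δᵢⱼ` (the Clifford algebra of the negative definite
quadratic form on `ℝⁿ`): elements are coordinate functions on the canonical basis
`(e_A)_{A ⊆ {0,…,n-1}}`, where `e_A` is the (increasingly ordered) product of the `e i`, `i ∈ A`. -/
def Cl (n : ℕ) : Type := Finset (Fin n) → ℝ

namespace Cl

variable {n : ℕ}

instance : NormedAddCommGroup (Cl n) :=
  inferInstanceAs (NormedAddCommGroup (Finset (Fin n) → ℝ))

instance : NormedSpace ℝ (Cl n) :=
  inferInstanceAs (NormedSpace ℝ (Finset (Fin n) → ℝ))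

/-- The coefficient of `a` at the basis element `e_A`. -/
def coeff (a : Cl n) (A : Finset (Fin n)) : ℝ := a A

/-- The sign occurring in the product `e_A * e_B = mulSign A B • e_{A ∆ B}`,
coming from the relations `eᵢ eⱼ = -eⱼ eᵢ` (i ≠ j) and `eᵢ² = -1`. -/
def mulSign (A B : Finset (Fin n)) : ℝ :=
  (-1 : ℝ) ^ (((A ×ˢ B).filter fun p => p.2 < p.1).card + (A ∩ B).card)

/-- Clifford multiplication. -/
def mul (a b : Cl n) : Cl n := fun C =>
  ∑ A : Finset (Fin n), ∑ B : Finset (Fin n),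
    if A ∆ B = C then mulSign A B * a A * b B else 0

/-- The unit `1` of the Clifford algebra. -/
def one : Cl n := Pi.single ∅ 1

/-- The embedding of the real scalars. -/
def scalar (r : ℝ) : Cl n := Pi.single ∅ r

/-- The generators `e i` (in the paper: `e_1, …, e_n`). -/
def e (i : Fin n) : Cl n := Pi.single {i} 1

/-- Reversion: the anti-automorphism fixing all the `e i`. -/
def reverse (a : Cl n) : Cl n := fun A => (-1 : ℝ) ^ (A.card * (A.card - 1) / 2) * a A

/-- The main involution `′`: the automorphism with `(e i)′ = - e i`. -/
def involute (a : Cl n) : Cl n := fun A => (-1 : ℝ) ^ A.card * a A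

/-- Clifford conjugation: the anti-automorphism with `conj (e i) = - e i`
(the composite of reversion and the main involution). -/
def conj (a : Cl n) : Cl n := fun A => (-1 : ℝ) ^ (A.card * (A.card + 1) / 2) * a A

/-- The norm on `Cl n`: the square root of the sum of the squares of the
coordinates in the standard basis. -/
def norm (a : Cl n) : ℝ := Real.sqrt (∑ A : Finset (Fin n), a A ^ 2)

/-- Invertibility in the Clifford algebra. -/
def IsInvertible (a : Cl n) : Prop := ∃ b, mul a b = one ∧ mul b a = one

/-- The inverse of an invertible Clifford number (junk value `0` otherwise). -/
def inv (a : Cl n) : Cl n :=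
  letI := Classical.propDecidable (IsInvertible a)
  if h : IsInvertible a then h.choose else 0

/-- The paravector `x₀ + x₁ e₁ + ⋯ + xₙ eₙ` attached to `x ∈ ℝ^{n+1}`. -/
def para (x : Fin (n + 1) → ℝ) : Cl n :=
  scalar (x 0) + ∑ i : Fin n, x i.succ • e i

/-- Being a paravector. -/
def IsParavector (a : Cl n) : Prop := ∃ x : Fin (n + 1) → ℝ, a = para x

/-- The coordinates in `ℝ^{n+1}` of (the paravector part of) a Clifford number. -/
def paraCoord (a : Cl n) : Fin (n + 1) → ℝ :=
  Fin.cases (coeff a ∅) (fun i => coeff a {i})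

/-- Being a (possibly empty) product of nonzero paravectors. -/
def IsProdOfParavectors (a : Cl n) : Prop :=
  ∃ l : List (Fin (n + 1) → ℝ), (∀ x ∈ l, x ≠ 0) ∧
    a = l.foldr (fun x b => mul (para x) b) one

/-- The special Ahlfors–Vahlen group `SAV(ℝ ⊕ ℝⁿ)`: 2×2 matrices `(a b; c d)` with entries
in `Cl n` such that each entry is `0` or a product of nonzero paravectors,
`a ⬝ reverse d - b ⬝ reverse c = 1`, and `a c⁻¹, c⁻¹ d` are paravectors if `c ≠ 0`
resp. `b d⁻¹` is a paravector if `c = 0`. -/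
structure SAV (n : ℕ) where
  a : Cl n
  b : Cl n
  c : Cl n
  d : Cl n
  prod_a : a = 0 ∨ IsProdOfParavectors a
  prod_b : b = 0 ∨ IsProdOfParavectors b
  prod_c : c = 0 ∨ IsProdOfParavectors c
  prod_d : d = 0 ∨ IsProdOfParavectors d
  det : mul a (reverse d) - mul b (reverse c) = one
  cond_c : c ≠ 0 → IsParavector (mul a (inv c)) ∧ IsParavector (mul (inv c) d)
  cond_c0 : c = 0 → IsParavector (mul b (inv d))

/-- The Clifford number `c x + d` attached to a matrix `M` and `x ∈ ℝ^{n+1}`. -/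
def cxd (M : SAV n) (x : Fin (n + 1) → ℝ) : Cl n := mul M.c (para x) + M.d

/-- The numerator `a x + b`. -/
def axb (M : SAV n) (x : Fin (n + 1) → ℝ) : Cl n := mul M.a (para x) + M.b

/-- The Möbius transformation `M<x> = (ax+b)(cx+d)⁻¹` as a Clifford number. -/
def moebiusCl (M : SAV n) (x : Fin (n + 1) → ℝ) : Cl n := mul (axb M x) (inv (cxd M x))

/-- The Möbius transformation `M<x>` as a point of `ℝ^{n+1}`. -/
def moebius (M : SAV n) (x : Fin (n + 1) → ℝ) : Fin (n + 1) → ℝ :=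
  paraCoord (moebiusCl M x)

/-- `a` lies in the subalgebra `Cl_{n-1}` generated by the `e j` with `j ≠ i`. -/
def memSub (a : Cl n) (i : Fin n) : Prop := ∀ A : Finset (Fin n), i ∈ A → coeff a A = 0

/-- The subgroup `SAV(ℝ ⊕ ℝ^{m})` of `SAV(ℝ ⊕ ℝ^{m+1})` of matrices whose entries lie
in the subalgebra `Cl_m ⊆ Cl_{m+1}`. -/
structure SAVsub (m : ℕ) extends SAV (m + 1) where
  sub_a : memSub a (Fin.last m)
  sub_b : memSub b (Fin.last m)
  sub_c : memSub c (Fin.last m)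
  sub_d : memSub d (Fin.last m)

/-- The `P`-part of `a ∈ Cl_{m+1} = Cl_m ⊕ Cl_m e_{top}`: `a = P a + (Q a) e_top`. -/
def Ppart {m : ℕ} (a : Cl (m + 1)) : Cl (m + 1) := fun A =>
  if Fin.last m ∈ A then 0 else a A

/-- The `Q`-part of `a ∈ Cl_{m+1} = Cl_m ⊕ Cl_m e_{top}`: `a = P a + (Q a) e_top`. -/
def Qpart {m : ℕ} (a : Cl (m + 1)) : Cl (m + 1) := fun A =>
  if Fin.last m ∈ A then 0 else a (insert (Fin.last m) A)

/-- Partial derivative `∂f/∂xᵢ`. -/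
def pderiv {E : Type*} [NormedAddCommGroup E] [NormedSpace ℝ E] {m : ℕ}
    (i : Fin m) (f : (Fin m → ℝ) → E) (x : Fin m → ℝ) : E :=
  fderiv ℝ f x (Pi.single i 1)

/-- The Euclidean Laplacian `Δ = Σᵢ ∂²/∂xᵢ²` (acting componentwise). -/
def lap {E : Type*} [NormedAddCommGroup E] [NormedSpace ℝ E] {m : ℕ}
    (f : (Fin m → ℝ) → E) : (Fin m → ℝ) → E :=
  fun x => ∑ i : Fin m, pderiv i (pderiv i f) x

/-- The Euclidean Dirac operator `D f = ∂f/∂x₀ + Σᵢ eᵢ ∂f/∂xᵢ`. -/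
def dirac (f : (Fin (n + 1) → ℝ) → Cl n) : (Fin (n + 1) → ℝ) → Cl n :=
  fun x => pderiv 0 f x + ∑ i : Fin n, mul (e i) (pderiv i.succ f x)

/-- Upper half-space `H⁺ = {x ∈ ℝ^{n+1} : xₙ > 0}`. -/
def upperHalf (n : ℕ) : Set (Fin (n + 1) → ℝ) := {x | 0 < x (Fin.last n)}

/-- The Euclidean norm on `ℝ^m`. -/
def enorm {m : ℕ} (x : Fin m → ℝ) : ℝ := Real.sqrt (∑ i, x i ^ 2)

end Cl

namespace Cl

/-! ### Algebraic structure -/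

section Algebra

variable {n : ℕ}

theorem mulSign_eq_prod (A B : Finset (Fin n)) :
    mulSign A B = ∏ p ∈ A, ∏ q ∈ B, if q ≤ p then (-1 : ℝ) else 1 := by
  have h1 : ∀ p q : Fin n, (if q ≤ p then (-1 : ℝ) else 1)
      = (if q < p then (-1 : ℝ) else 1) * (if p = q then (-1 : ℝ) else 1) := by
    intro p q
    rcases lt_trichotomy q p with h | h | h
    · simp [h, h.le, h.ne']
    · simp [h]
    · simp [h.not_gt, h.not_ge, h.ne]
  simp only [h1, Finset.prod_mul_distrib, Finset.prod_ite_eq]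
  rw [mulSign, pow_add, ← Finset.prod_product', Finset.prod_ite_mem, Finset.prod_const,
    Finset.prod_ite]
  simp

theorem prod_symmDiff_of_sq_eq_one {ι : Type*} [Fintype ι] [DecidableEq ι] (g : ι → ℝ)
    (hg : ∀ i, g i * g i = 1) (A B : Finset ι) :
    ∏ i ∈ A ∆ B, g i = (∏ i ∈ A, g i) * ∏ i ∈ B, g i := by
  have h : ∀ S : Finset ι, ∏ i ∈ S, g i = ∏ i, if i ∈ S then g i else 1 := by
    intro S; simp [Finset.prod_ite_mem]
  rw [h, h A, h B, ← Finset.prod_mul_distrib]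
  refine Finset.prod_congr rfl fun i _ => ?_
  by_cases hA : i ∈ A <;> by_cases hB : i ∈ B <;> simp [Finset.mem_symmDiff, hA, hB, hg]

theorem mulSign_symmDiff_right (A B C : Finset (Fin n)) :
    mulSign A (B ∆ C) = mulSign A B * mulSign A C := by
  simp only [mulSign_eq_prod, ← Finset.prod_mul_distrib]
  refine Finset.prod_congr rfl fun p _ => prod_symmDiff_of_sq_eq_one _ (fun q => ?_) _ _
  split_ifs <;> norm_num

theorem mulSign_symmDiff_left (A B C : Finset (Fin n)) :
    mulSign (A ∆ B) C = mulSign A C * mulSign B C := by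
  simp only [mulSign_eq_prod]
  refine prod_symmDiff_of_sq_eq_one _ (fun p => ?_) _ _
  rw [← Finset.prod_mul_distrib]
  refine Finset.prod_eq_one fun q _ => ?_
  split_ifs <;> norm_num

theorem mulSign_mul_self (A B : Finset (Fin n)) : mulSign A B * mulSign A B = 1 := by
  rw [mulSign, ← pow_add, ← two_mul, pow_mul]; norm_num

theorem mulSign_empty_left (A : Finset (Fin n)) : mulSign ∅ A = 1 := by simp [mulSign]

theorem mulSign_empty_right (A : Finset (Fin n)) : mulSign A ∅ = 1 := by simp [mulSign]

/-- The sign of Clifford conjugation on `e_A` is the sign of the square of `e_A`. -/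
theorem mulSign_self (A : Finset (Fin n)) :
    mulSign A A = (-1 : ℝ) ^ (A.card * (A.card + 1) / 2) := by
  induction A using Finset.induction_on_max with
  | empty => simp [mulSign]
  | insert a s hs ih =>
    have ha : a ∉ s := fun h => lt_irrefl _ (hs a h)
    have hd : insert a s = {a} ∆ s := by
      ext i
      simp only [Finset.mem_insert, Finset.mem_symmDiff, Finset.mem_singleton]
      by_cases hi : i = a
      · subst hi; simp [ha]
      · simp [hi]
    have h1 : mulSign {a} s = (-1 : ℝ) ^ s.card := by
      rw [mulSign_eq_prod, Finset.prod_singleton,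
        Finset.prod_congr rfl (g := fun _ => (-1 : ℝ)) (fun q hq => by simp [(hs q hq).le])]
      simp
    have h2 : mulSign s {a} = 1 := by
      rw [mulSign_eq_prod]
      refine Finset.prod_eq_one fun p hp => ?_
      simp [hs p hp]
    have h3 : mulSign {a} {a} = -1 := by simp [mulSign_eq_prod]
    have hc : (s.card + 1) * (s.card + 1 + 1) / 2 = s.card * (s.card + 1) / 2 + (s.card + 1) := by
      rw [← Nat.add_mul_div_right _ _ (by norm_num : 0 < 2)]
      congr 1; ring
    rw [Finset.card_insert_of_notMem ha, hc, hd, mulSign_symmDiff_left, mulSign_symmDiff_right,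
      mulSign_symmDiff_right, h1, h2, h3, ih, pow_add, pow_succ]
    ring

theorem mul_apply (a b : Cl n) (C : Finset (Fin n)) :
    mul a b C = ∑ A, mulSign A (A ∆ C) * a A * b (A ∆ C) := by
  unfold mul
  refine Finset.sum_congr rfl fun A _ => ?_
  rw [Finset.sum_eq_single (A ∆ C)]
  · simp
  · intro B _ hB
    rw [if_neg]
    rintro rfl
    exact hB (by simp)
  · simp

theorem mul_assoc' (a b c : Cl n) : mul (mul a b) c = mul a (mul b c) := by
  funext D
  rw [mul_apply, mul_apply]
  simp only [mul_apply, Finset.sum_mul, Finset.mul_sum]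
  rw [Finset.sum_comm]
  refine Finset.sum_congr rfl fun A _ => ?_
  have hinv : Function.Involutive fun X : Finset (Fin n) => A ∆ X := fun X => by simp
  rw [← Equiv.sum_comp hinv.toPerm]
  refine Finset.sum_congr rfl fun X _ => ?_
  simp only [Function.Involutive.coe_toPerm]
  have e1 : X ∆ (A ∆ D) = A ∆ X ∆ D := by
    rw [symmDiff_left_comm, symmDiff_assoc]
  have e2 : A ∆ (A ∆ X) = X := by simp
  have h : mulSign (A ∆ X) (A ∆ X ∆ D) * mulSign A X
      = mulSign A (A ∆ D) * mulSign X (A ∆ X ∆ D) := by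
    simp only [mulSign_symmDiff_left, mulSign_symmDiff_right]
    linear_combination (mulSign A A * mulSign A D * mulSign X A * mulSign X X * mulSign X D)
      * mulSign_mul_self A X
  simp only [e1, e2]
  linear_combination (a A * b X * c (A ∆ X ∆ D)) * h

theorem empty_symmDiff (A : Finset (Fin n)) : ∅ ∆ A = A := by
  ext; simp [Finset.mem_symmDiff]

theorem symmDiff_empty (A : Finset (Fin n)) : A ∆ ∅ = A := by
  ext; simp [Finset.mem_symmDiff]

theorem one_apply (A : Finset (Fin n)) : (one : Cl n) A = if A = ∅ then 1 else 0 := by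
  simp [one, Pi.single_apply]

theorem one_mul' (a : Cl n) : mul one a = a := by
  funext C
  rw [mul_apply, Finset.sum_eq_single ∅]
  · rw [empty_symmDiff, mulSign_empty_left, one_apply, if_pos rfl]; ring
  · intro A _ hA; simp [one_apply, hA]
  · simp

theorem mul_one' (a : Cl n) : mul a one = a := by
  funext C
  rw [mul_apply, Finset.sum_eq_single C]
  · simp [one_apply, mulSign_empty_right]
  · intro A _ hA; simp [one_apply, symmDiff_eq_bot.not.2 hA, ← Finset.bot_eq_empty]
  · simp

theorem add_apply (a b : Cl n) (A : Finset (Fin n)) : (a + b) A = a A + b A := rfl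

theorem smul_apply (r : ℝ) (a : Cl n) (A : Finset (Fin n)) : (r • a) A = r * a A := rfl

theorem zero_apply (A : Finset (Fin n)) : (0 : Cl n) A = 0 := rfl

scoped instance : Ring (Cl n) :=
  { (inferInstance : AddCommGroup (Cl n)) with
    mul := mul
    one := one
    mul_assoc := mul_assoc'
    one_mul := one_mul'
    mul_one := mul_one'
    left_distrib := fun a b c => by
      change mul a (b + c) = mul a b + mul a c
      funext C
      rw [add_apply, mul_apply, mul_apply, mul_apply, ← Finset.sum_add_distrib]
      exact Finset.sum_congr rfl fun A _ => by rw [add_apply, mul_add]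
    right_distrib := fun a b c => by
      change mul (a + b) c = mul a c + mul b c
      funext C
      rw [add_apply, mul_apply, mul_apply, mul_apply, ← Finset.sum_add_distrib]
      exact Finset.sum_congr rfl fun A _ => by rw [add_apply]; ring
    zero_mul := fun a => by
      change mul 0 a = 0
      funext C
      rw [mul_apply, zero_apply]
      exact Finset.sum_eq_zero fun A _ => by rw [zero_apply]; ring
    mul_zero := fun a => by
      change mul a 0 = 0
      funext C
      rw [mul_apply, zero_apply]
      exact Finset.sum_eq_zero fun A _ => by rw [zero_apply]; ring }

theorem mul_eq (a b : Cl n) : mul a b = a * b := rfl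

theorem one_eq : (one : Cl n) = 1 := rfl

scoped instance : Algebra ℝ (Cl n) :=
  Algebra.ofModule
    (fun r a b => by
      change mul (r • a) b = r • mul a b
      funext C
      rw [smul_apply, mul_apply, mul_apply, Finset.mul_sum]
      exact Finset.sum_congr rfl fun A _ => by rw [smul_apply]; ring)
    (fun r a b => by
      change mul a (r • b) = r • mul a b
      funext C
      rw [smul_apply, mul_apply, mul_apply, Finset.mul_sum]
      exact Finset.sum_congr rfl fun A _ => by rw [smul_apply]; ring)

scoped instance : FiniteDimensional ℝ (Cl n) :=
  inferInstanceAs (FiniteDimensional ℝ (Finset (Fin n) → ℝ))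

theorem mul_apply_empty (a b : Cl n) : (a * b) ∅ = ∑ A, mulSign A A * a A * b A := by
  rw [← mul_eq, mul_apply]
  exact Finset.sum_congr rfl fun A _ => by rw [symmDiff_empty]

theorem conj_apply (a : Cl n) (A : Finset (Fin n)) : conj a A = mulSign A A * a A := by
  rw [mulSign_self]; rfl

theorem conj_mul (a b : Cl n) : conj (a * b) = conj b * conj a := by
  funext C
  rw [conj_apply, ← mul_eq, ← mul_eq, mul_apply, mul_apply, Finset.mul_sum]
  have hinv : Function.Involutive fun X : Finset (Fin n) => X ∆ C := fun X => by simp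
  rw [← Equiv.sum_comp hinv.toPerm]
  refine Finset.sum_congr rfl fun A _ => ?_
  have e1 : A ∆ C ∆ C = A := by simp
  simp only [Function.Involutive.coe_toPerm, e1, conj_apply]
  have h : mulSign C C * mulSign (A ∆ C) A
      = mulSign A (A ∆ C) * mulSign A A * mulSign (A ∆ C) (A ∆ C) := by
    simp only [mulSign_symmDiff_left, mulSign_symmDiff_right]
    linear_combination (-mulSign A A * mulSign C A * mulSign C C) *
      (mulSign_mul_self A C + mulSign A C * mulSign A C * mulSign_mul_self A A)
  linear_combination (a (A ∆ C) * b A) * h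

theorem involute_mul (a b : Cl n) : involute (a * b) = involute a * involute b := by
  funext C
  change (-1 : ℝ) ^ C.card * mul a b C = mul (involute a) (involute b) C
  rw [mul_apply, mul_apply, Finset.mul_sum]
  refine Finset.sum_congr rfl fun A _ => ?_
  have hsign : (-1 : ℝ) ^ A.card * (-1 : ℝ) ^ (A ∆ C).card = (-1 : ℝ) ^ C.card := by
    simp only [← Finset.prod_const]
    rw [← prod_symmDiff_of_sq_eq_one (fun _ => (-1 : ℝ)) (fun _ => by norm_num),
      symmDiff_symmDiff_cancel_left]
  change _ = mulSign A (A ∆ C) * ((-1 : ℝ) ^ A.card * a A) *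
    ((-1 : ℝ) ^ (A ∆ C).card * b (A ∆ C))
  rw [← hsign]
  ring

theorem reverse_eq (a : Cl n) : reverse a = involute (conj a) := by
  funext A
  change (-1 : ℝ) ^ (A.card * (A.card - 1) / 2) * a A =
    (-1 : ℝ) ^ A.card * ((-1 : ℝ) ^ (A.card * (A.card + 1) / 2) * a A)
  rcases Nat.eq_zero_or_pos A.card with h | h
  · simp [h]
  · obtain ⟨j, hj⟩ := Nat.exists_eq_add_of_lt h
    have hj' : A.card = j + 1 := by omega
    rw [hj']
    have hc : (j + 1) * (j + 1 + 1) / 2 = (j + 1) * (j + 1 - 1) / 2 + (j + 1) := by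
      rw [← Nat.add_mul_div_right _ _ (by norm_num : 0 < 2)]
      congr 1; simp; ring
    have h2 : (-1 : ℝ) ^ (j + 1) * (-1 : ℝ) ^ (j + 1) = 1 := by
      rw [← pow_add, ← two_mul, pow_mul]; norm_num
    rw [hc, pow_add]
    linear_combination (-(-1 : ℝ) ^ ((j + 1) * (j + 1 - 1) / 2) * a A) * h2

theorem reverse_mul (a b : Cl n) : reverse (a * b) = reverse b * reverse a := by
  rw [reverse_eq, reverse_eq, reverse_eq, conj_mul, involute_mul]

theorem conj_add (a b : Cl n) : conj (a + b) = conj a + conj b := by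
  funext A; exact mul_add _ _ _

theorem conj_smul (r : ℝ) (a : Cl n) : conj (r • a) = r • conj a := by
  funext A; exact mul_left_comm _ _ _

theorem reverse_smul (r : ℝ) (a : Cl n) : reverse (r • a) = r • reverse a := by
  funext A; exact mul_left_comm _ _ _

theorem conj_one : conj (1 : Cl n) = 1 := by
  funext A
  rw [conj_apply, ← one_eq, one_apply]
  split_ifs with h
  · rw [h, mulSign_empty_left, mul_one]
  · rw [mul_zero]

theorem reverse_one : reverse (1 : Cl n) = 1 := by
  rw [reverse_eq, conj_one]
  funext A
  change _ * (one : Cl n) A = (one : Cl n) A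
  rw [one_apply]
  split_ifs with h <;> simp [h]

theorem reverse_conj (a : Cl n) : reverse (conj a) = conj (reverse a) := by
  funext A; exact mul_left_comm _ _ _

/-! ### Paravectors -/

/-- The basis `1, e 0, …, e (n-1)` of the space of paravectors. -/
def basisPara (i : Fin (n + 1)) : Cl n := Fin.cases 1 e i

theorem para_eq_sum (x : Fin (n + 1) → ℝ) : para x = ∑ i, x i • basisPara i := by
  rw [Fin.sum_univ_succ, para]
  congr 1
  funext A
  rw [smul_apply]
  change (Pi.single ∅ (x 0) : Finset (Fin n) → ℝ) A = x 0 * (one : Cl n) A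
  rw [one_apply]
  simp [Pi.single_apply]

theorem para_add (x y : Fin (n + 1) → ℝ) : para (x + y) = para x + para y := by
  simp only [para_eq_sum, Pi.add_apply, add_smul, Finset.sum_add_distrib]

theorem para_smul (r : ℝ) (x : Fin (n + 1) → ℝ) : para (r • x) = r • para x := by
  simp only [para_eq_sum, Pi.smul_apply, smul_eq_mul, mul_smul, Finset.smul_sum]

theorem para_sub (x y : Fin (n + 1) → ℝ) : para (x - y) = para x - para y := by
  simp only [para_eq_sum, Pi.sub_apply, sub_smul, Finset.sum_sub_distrib]

theorem para_zero : para (0 : Fin (n + 1) → ℝ) = 0 := by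
  simp [para_eq_sum]

/-- The element `e_A` of the canonical basis. -/
def basisEl (A : Finset (Fin n)) : Cl n := Pi.single A 1

theorem basisEl_apply (A B : Finset (Fin n)) : basisEl A B = if B = A then 1 else 0 :=
  Pi.single_apply A 1 B

theorem basisEl_mul (A B : Finset (Fin n)) :
    basisEl A * basisEl B = mulSign A B • basisEl (A ∆ B) := by
  funext C
  rw [smul_apply, ← mul_eq, mul_apply, Finset.sum_eq_single A]
  · rw [basisEl_apply, basisEl_apply, basisEl_apply, if_pos rfl]
    by_cases hC : A ∆ C = B
    · rw [if_pos hC, ← hC, symmDiff_symmDiff_cancel_left, if_pos rfl]; ring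
    · have hC' : C ≠ A ∆ B := by
        rintro rfl; exact hC (symmDiff_symmDiff_cancel_left _ _)
      rw [if_neg hC, if_neg hC']; ring
  · intro X _ hX
    rw [basisEl_apply, if_neg hX]; ring
  · simp

theorem basisEl_empty : basisEl (∅ : Finset (Fin n)) = 1 := rfl

theorem e_mul_e (i j : Fin n) : e i * e j + e j * e i = if i = j then (-2 : ℝ) • 1 else 0 := by
  change basisEl {i} * basisEl {j} + basisEl {j} * basisEl {i} = _
  rw [basisEl_mul, basisEl_mul]
  split_ifs with hij
  · subst hij
    have h1 : mulSign {i} {i} = -1 := by simp [mulSign_eq_prod]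
    have h2 : ({i} : Finset (Fin n)) ∆ {i} = ∅ := by simp
    rw [h1, h2, ← add_smul, basisEl_empty]; norm_num
  · have h1 : mulSign {i} {j} = - mulSign {j} {i} := by
      simp only [mulSign_eq_prod, Finset.prod_singleton]
      rcases lt_or_gt_of_ne hij with h | h
      · simp [h.le, h.not_ge]
      · simp [h.le, h.not_ge]
    rw [h1, symmDiff_comm, neg_smul, neg_add_cancel]

theorem vector_mul_self (v : Fin n → ℝ) :
    (∑ i, v i • e i) * ∑ i, v i • e i = -(∑ i, v i ^ 2) • (1 : Cl n) := by
  have h : (∑ i, v i • e i) * (∑ i, v i • e i) + (∑ i, v i • e i) * (∑ i, v i • e i)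
      = (-2 * ∑ i, v i ^ 2) • (1 : Cl n) := by
    conv_lhs =>
      congr
      · rw [Finset.sum_mul_sum]
      · rw [Finset.sum_mul_sum, Finset.sum_comm]
    simp only [← Finset.sum_add_distrib, smul_mul_smul_comm]
    have h1 : ∀ i j : Fin n, (v i * v j) • (e i * e j) + (v j * v i) • (e j * e i)
        = if i = j then (-2 * v i ^ 2) • (1 : Cl n) else 0 := by
      intro i j
      rw [mul_comm (v j), ← smul_add, e_mul_e]
      split_ifs with hij
      · rw [hij, smul_smul]; congr 1; ring
      · rw [smul_zero]
    simp only [h1, Finset.sum_ite_eq, Finset.mem_univ, if_true, ← Finset.sum_smul, Finset.mul_sum]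
  have h2 : (2 : ℝ) • ((∑ i, v i • e i) * (∑ i, v i • e i))
      = (2 : ℝ) • (-(∑ i, v i ^ 2) • (1 : Cl n)) := by
    rw [two_smul, h, smul_smul]; congr 1; ring
  exact smul_right_injective _ (two_ne_zero) h2

theorem sum_apply {ι : Type*} (s : Finset ι) (g : ι → Cl n) (A : Finset (Fin n)) :
    (∑ i ∈ s, g i) A = ∑ i ∈ s, g i A :=
  Finset.sum_apply (M := fun _ : Finset (Fin n) => ℝ) A s g

/-- The conjugate of a paravector, in coordinates. -/
def conjVec (x : Fin (n + 1) → ℝ) : Fin (n + 1) → ℝ := Fin.cons (x 0) fun i => -x i.succ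

theorem para_eq (x : Fin (n + 1) → ℝ) : para x = x 0 • 1 + ∑ i : Fin n, x i.succ • e i := by
  rw [para_eq_sum, Fin.sum_univ_succ]; rfl

theorem para_apply_empty (x : Fin (n + 1) → ℝ) : para x ∅ = x 0 := by
  have h : ∀ i : Fin n, (x i.succ • e i : Cl n) ∅ = 0 := fun i => by
    change x i.succ * basisEl {i} ∅ = 0
    rw [basisEl_apply, if_neg (Finset.singleton_ne_empty i).symm, mul_zero]
  rw [para, add_apply, sum_apply, Finset.sum_eq_zero fun i _ => h i, add_zero]
  exact Pi.single_eq_same (M := fun _ : Finset (Fin n) => ℝ) ∅ (x 0)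

theorem para_apply_singleton (x : Fin (n + 1) → ℝ) (j : Fin n) : para x {j} = x j.succ := by
  have h : ∀ i : Fin n, (x i.succ • e i : Cl n) {j} = if i = j then x i.succ else 0 := fun i => by
    change x i.succ * basisEl {i} {j} = _
    rw [basisEl_apply]
    by_cases hij : i = j
    · simp [hij]
    · simp [hij, Ne.symm hij]
  rw [para_eq, add_apply, sum_apply, Finset.sum_congr rfl fun i _ => h i,
    Finset.sum_ite_eq' Finset.univ j,
    if_pos (Finset.mem_univ j)]
  change x 0 * basisEl ∅ {j} + _ = _
  rw [basisEl_apply, if_neg (Finset.singleton_ne_empty j), mul_zero, zero_add]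

theorem paraCoord_para (x : Fin (n + 1) → ℝ) : paraCoord (para x) = x := by
  funext i
  refine Fin.cases ?_ (fun j => ?_) i
  · exact para_apply_empty x
  · exact para_apply_singleton x j

theorem conj_para (x : Fin (n + 1) → ℝ) : conj (para x) = para (conjVec x) := by
  have hsum : ∀ s : Finset (Fin n), conj (∑ i ∈ s, x i.succ • e i)
      = ∑ i ∈ s, (-x i.succ) • (e i : Cl n) := by
    intro s
    induction s using Finset.induction_on with
    | empty => funext A; exact mul_zero _
    | insert a s ha ih =>
      rw [Finset.sum_insert ha, Finset.sum_insert ha, conj_add, ih, conj_smul]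
      congr 1
      funext A
      rw [smul_apply, conj_apply, smul_apply]
      change _ * (_ * basisEl {a} A) = _ * basisEl {a} A
      rw [basisEl_apply]
      split_ifs with h
      · rw [h]; simp [mulSign_eq_prod]
      · simp
  rw [para_eq, para_eq, conj_add, conj_smul, conj_one, hsum]
  rfl

theorem involute_para (x : Fin (n + 1) → ℝ) : involute (para x) = para (conjVec x) := by
  have hadd : ∀ a b : Cl n, involute (a + b) = involute a + involute b := fun a b => by
    funext A; exact mul_add _ _ _
  have hsum : ∀ s : Finset (Fin n), involute (∑ i ∈ s, x i.succ • e i)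
      = ∑ i ∈ s, (-x i.succ) • (e i : Cl n) := by
    intro s
    induction s using Finset.induction_on with
    | empty => funext A; exact mul_zero _
    | insert a s ha ih =>
      rw [Finset.sum_insert ha, Finset.sum_insert ha, hadd, ih]
      congr 1
      funext A
      change _ * (_ * basisEl {a} A) = _ * basisEl {a} A
      rw [basisEl_apply]
      split_ifs with h
      · rw [h]; simp
      · simp
  rw [para_eq, para_eq, hadd, hsum]
  congr 1
  funext A
  change _ * (_ * basisEl ∅ A) = x 0 * basisEl ∅ A
  rw [basisEl_apply]
  split_ifs with h
  · rw [h]; simp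
  · simp

theorem conjVec_conjVec (x : Fin (n + 1) → ℝ) : conjVec (conjVec x) = x := by
  funext i
  refine Fin.cases ?_ (fun j => ?_) i <;> simp [conjVec]

theorem reverse_para (x : Fin (n + 1) → ℝ) : reverse (para x) = para x := by
  rw [reverse_eq, conj_para, involute_para, conjVec_conjVec]

theorem conjVec_dot (x : Fin (n + 1) → ℝ) : conjVec x ⬝ᵥ conjVec x = x ⬝ᵥ x := by
  simp [dotProduct, Fin.sum_univ_succ, conjVec]

theorem para_mul_conj (x : Fin (n + 1) → ℝ) : para x * conj (para x) = (x ⬝ᵥ x) • 1 := by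
  have h := vector_mul_self fun i : Fin n => x i.succ
  have h1 : conj (para x) = x 0 • 1 - ∑ i : Fin n, x i.succ • e i := by
    rw [conj_para, para_eq, sub_eq_add_neg, ← Finset.sum_neg_distrib]
    simp only [conjVec, Fin.cons_succ, Fin.cons_zero, neg_smul]
  have h2 : x ⬝ᵥ x = x 0 * x 0 + ∑ i : Fin n, x i.succ ^ 2 := by
    simp [dotProduct, Fin.sum_univ_succ, sq]
  rw [h1, para_eq, h2]
  generalize (∑ i : Fin n, x i.succ • e i) = v at *
  have h3 : (x 0 • 1 + v) * (x 0 • 1 - v) = (x 0 * x 0) • 1 - v * v := by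
    simp only [add_mul, mul_sub, smul_mul_assoc, mul_smul_comm, one_mul, mul_one, smul_add,
      mul_smul]
    abel
  rw [h3, h, add_smul, neg_smul, sub_neg_eq_add]

theorem conj_mul_para (x : Fin (n + 1) → ℝ) : conj (para x) * para x = (x ⬝ᵥ x) • 1 := by
  have h := para_mul_conj (conjVec x)
  rwa [conjVec_dot, ← conj_para, conj_para, conj_para, conjVec_conjVec, ← conj_para] at h

theorem para_mul_mul (p y : Fin (n + 1) → ℝ) :
    para p * para y * para p
      = para ((2 * (conjVec y ⬝ᵥ p)) • p - (p ⬝ᵥ p) • conjVec y) := by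
  have h1 := para_mul_conj (p + conjVec y)
  have h2 := para_mul_conj p
  have h3 := para_mul_conj (conjVec y)
  rw [para_add, conj_add, add_mul, mul_add, mul_add, h2, h3, conj_para (conjVec y),
    conjVec_conjVec] at h1
  have h4 : (p + conjVec y) ⬝ᵥ (p + conjVec y)
      = p ⬝ᵥ p + 2 * (conjVec y ⬝ᵥ p) + conjVec y ⬝ᵥ conjVec y := by
    rw [add_dotProduct, dotProduct_add, dotProduct_add, dotProduct_comm p (conjVec y)]; ring
  rw [h4, add_smul, add_smul] at h1
  have h5 : para p * para y = (2 * (conjVec y ⬝ᵥ p)) • 1 - para (conjVec y) * conj (para p) := by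
    rw [eq_sub_iff_add_eq]
    have h6 := sub_eq_zero.2 h1
    rw [← sub_eq_zero, ← h6]
    abel
  rw [h5, sub_mul, mul_assoc, conj_mul_para, para_sub, para_smul, para_smul, smul_mul_assoc,
    one_mul, mul_smul_comm, mul_one]

/-! ### Products of paravectors -/

theorem norm_eq_sqrt {a : Cl n} {r : ℝ} (h : conj a * a = r • 1) : norm a = √r := by
  have h1 : (conj a * a) ∅ = r * (basisEl ∅ : Cl n) ∅ := by rw [h]; rfl
  rw [mul_apply_empty, basisEl_apply, if_pos rfl, mul_one] at h1
  rw [norm, ← h1]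
  congr 1
  refine Finset.sum_congr rfl fun A _ => ?_
  rw [conj_apply]
  linear_combination (-(a A) ^ 2) * mulSign_mul_self A A

/-- A product of nonzero paravectors has an inverse proportional to its conjugate, and
its twisted adjoint action preserves the paravectors. -/
theorem IsProdOfParavectors.spec {a : Cl n} (ha : IsProdOfParavectors a) :
    ∃ r : ℝ, 0 < r ∧ conj a * a = r • 1 ∧ a * conj a = r • 1 ∧
      ∀ y, IsParavector (a * para y * reverse a) := by
  obtain ⟨l, hl, rfl⟩ := ha
  induction l with
  | nil =>
    refine ⟨1, one_pos, ?_⟩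
    simp [one_eq, conj_one, reverse_one, IsParavector]
  | cons p l ih =>
    obtain ⟨r, hr, h1, h2, h3⟩ := ih fun x hx => hl x (List.mem_cons_of_mem _ hx)
    rw [List.foldr_cons, mul_eq]
    generalize l.foldr (fun x b => mul (para x) b) one = b at *
    have hp : p ≠ 0 := hl p List.mem_cons_self
    refine ⟨p ⬝ᵥ p * r, mul_pos ?_ hr, ?_, ?_, ?_⟩
    · exact lt_of_le_of_ne (Finset.sum_nonneg fun i _ => mul_self_nonneg _)
        (Ne.symm (by simpa [dotProduct_self_eq_zero] using hp))
    · rw [conj_mul, mul_assoc, ← mul_assoc _ _ b, conj_mul_para, smul_mul_assoc, one_mul,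
        mul_smul_comm, h1, smul_smul]
    · rw [conj_mul, mul_assoc, ← mul_assoc b, h2, smul_mul_assoc, one_mul,
        mul_smul_comm, para_mul_conj, smul_smul, mul_comm]
    · intro y
      obtain ⟨z, hz⟩ := h3 y
      refine ⟨_, (Eq.trans ?_ (para_mul_mul p z))⟩
      rw [reverse_mul, reverse_para, ← hz]
      simp only [mul_assoc]

theorem inv_eq {a b : Cl n} (h1 : a * b = 1) (h2 : b * a = 1) : inv a = b := by
  have h : IsInvertible a := ⟨b, h1, h2⟩
  have h3 : inv a = h.choose := by simp only [inv, dif_pos h]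
  have h4 := h.choose_spec
  rw [← h3] at h4
  calc inv a = inv a * (a * b) := by rw [h1, mul_one]
    _ = (inv a * a) * b := (mul_assoc _ _ _).symm
    _ = b := by rw [show inv a * a = 1 from h4.2, one_mul]

end Algebra
end Cl

namespace Cl

/-! ### Partial derivatives of smooth functions on open sets -/

section Analysis

open scoped ContDiff

variable {E G : Type*} [NormedAddCommGroup E] [NormedSpace ℝ E]
  [NormedAddCommGroup G] [NormedSpace ℝ G] {m : ℕ} {Ω : Set (Fin m → ℝ)}
  {u v : (Fin m → ℝ) → E}

theorem pderiv_congr (hΩ : IsOpen Ω) (h : Set.EqOn u v Ω) (i : Fin m) :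
    Set.EqOn (pderiv i u) (pderiv i v) Ω := fun x hx => by
  unfold pderiv
  rw [(h.eventuallyEq_of_mem (hΩ.mem_nhds hx)).fderiv_eq]

theorem contDiffOn_pderiv (hΩ : IsOpen Ω) (hu : ContDiffOn ℝ ∞ u Ω) (i : Fin m) :
    ContDiffOn ℝ ∞ (pderiv i u) Ω :=
  (hu.fderiv_of_isOpen hΩ (by simp)).clm_apply contDiffOn_const

theorem differentiableAt_of_contDiffOn (hΩ : IsOpen Ω) (hu : ContDiffOn ℝ ∞ u Ω) {x : Fin m → ℝ}
    (hx : x ∈ Ω) : DifferentiableAt ℝ u x :=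
  (hu.contDiffAt (hΩ.mem_nhds hx)).differentiableAt (by simp)

theorem pderiv_add {x : Fin m → ℝ} (hu : DifferentiableAt ℝ u x) (hv : DifferentiableAt ℝ v x)
    (i : Fin m) : pderiv i (fun y => u y + v y) x = pderiv i u x + pderiv i v x := by
  unfold pderiv; rw [fderiv_fun_add hu hv]; rfl

theorem pderiv_sub {x : Fin m → ℝ} (hu : DifferentiableAt ℝ u x) (hv : DifferentiableAt ℝ v x)
    (i : Fin m) : pderiv i (fun y => u y - v y) x = pderiv i u x - pderiv i v x := by
  unfold pderiv; rw [fderiv_fun_sub hu hv]; rfl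

theorem pderiv_sum {ι : Type*} {s : Finset ι} {w : ι → (Fin m → ℝ) → E} {x : Fin m → ℝ}
    (hw : ∀ a ∈ s, DifferentiableAt ℝ (w a) x) (i : Fin m) :
    pderiv i (fun y => ∑ a ∈ s, w a y) x = ∑ a ∈ s, pderiv i (w a) x := by
  unfold pderiv; rw [fderiv_fun_sum hw]; simp

theorem pderiv_clm (L : E →L[ℝ] G) {x : Fin m → ℝ} (hu : DifferentiableAt ℝ u x) (i : Fin m) :
    pderiv i (fun y => L (u y)) x = L (pderiv i u x) := by
  unfold pderiv
  have := (L.hasFDerivAt.comp x hu.hasFDerivAt).fderiv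
  simp only [Function.comp_def] at this
  rw [this]; rfl

theorem pderiv_const_smul (r : ℝ) {x : Fin m → ℝ} (hu : DifferentiableAt ℝ u x) (i : Fin m) :
    pderiv i (fun y => r • u y) x = r • pderiv i u x :=
  pderiv_clm (r • ContinuousLinearMap.id ℝ E) hu i

theorem pderiv_smul {φ : (Fin m → ℝ) → ℝ} {x : Fin m → ℝ} (hφ : DifferentiableAt ℝ φ x)
    (hu : DifferentiableAt ℝ u x) (i : Fin m) :
    pderiv i (fun y => φ y • u y) x = φ x • pderiv i u x + pderiv i φ x • u x := by
  unfold pderiv; rw [fderiv_fun_smul hφ hu]; simp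

theorem pderiv_coord (i j : Fin m) (x : Fin m → ℝ) :
    pderiv i (fun y => y j) x = if j = i then 1 else 0 := by
  unfold pderiv
  rw [(hasFDerivAt_apply j x).fderiv]
  simp [Pi.single_apply]

theorem pderiv_comm (hΩ : IsOpen Ω) (hu : ContDiffOn ℝ ∞ u Ω) (i j : Fin m) :
    Set.EqOn (pderiv i (pderiv j u)) (pderiv j (pderiv i u)) Ω := fun x hx => by
  have hd : DifferentiableAt ℝ (fderiv ℝ u) x :=
    ((hu.fderiv_of_isOpen hΩ (m := ∞) (by simp)).contDiffAt (hΩ.mem_nhds hx)).differentiableAt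
      (by simp)
  have h : ∀ i j : Fin m, pderiv i (pderiv j u) x
      = fderiv ℝ (fderiv ℝ u) x (Pi.single i 1) (Pi.single j 1) := fun i j => by
    change fderiv ℝ (fun y => fderiv ℝ u y (Pi.single j 1)) x (Pi.single i 1) = _
    rw [fderiv_clm_apply hd (differentiableAt_const _)]
    simp
  rw [h, h]
  exact (hu.contDiffAt (hΩ.mem_nhds hx)).isSymmSndFDerivAt
    (by simpa using WithTop.coe_le_coe.2 (le_top : (2 : ℕ∞) ≤ ⊤)) _ _

theorem fderiv_eq_sum_pderiv (u : (Fin m → ℝ) → E) (x w : Fin m → ℝ) :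
    fderiv ℝ u x w = ∑ j, w j • pderiv j u x := by
  conv_lhs => rw [pi_eq_sum_univ' w]
  simp [pderiv, map_sum]

theorem pderiv_comp {φ : (Fin m → ℝ) → Fin m → ℝ} {x : Fin m → ℝ}
    (hu : DifferentiableAt ℝ u (φ x)) (hφ : ∀ j, DifferentiableAt ℝ (fun y => φ y j) x)
    (i : Fin m) :
    pderiv i (fun y => u (φ y)) x = ∑ j, pderiv i (fun y => φ y j) x • pderiv j u (φ x) := by
  have hφ' : DifferentiableAt ℝ φ x := differentiableAt_pi.2 hφ
  have h := fderiv_comp x hu hφ'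
  simp only [Function.comp_def] at h
  rw [pderiv, h, ContinuousLinearMap.comp_apply, fderiv_eq_sum_pderiv]
  refine Finset.sum_congr rfl fun j _ => ?_
  rw [pderiv, pderiv, fderiv_apply hφ' j]
  rfl

/-! ### The Laplacian -/

theorem lap_congr (hΩ : IsOpen Ω) (h : Set.EqOn u v Ω) : Set.EqOn (lap u) (lap v) Ω :=
  fun _ hx => Finset.sum_congr rfl fun i _ => pderiv_congr hΩ (pderiv_congr hΩ h i) i hx

theorem contDiffOn_lap (hΩ : IsOpen Ω) (hu : ContDiffOn ℝ ∞ u Ω) : ContDiffOn ℝ ∞ (lap u) Ω :=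
  ContDiffOn.sum fun i _ => contDiffOn_pderiv hΩ (contDiffOn_pderiv hΩ hu i) i

theorem lap_clm (L : E →L[ℝ] G) (hΩ : IsOpen Ω) (hu : ContDiffOn ℝ ∞ u Ω) :
    Set.EqOn (lap fun y => L (u y)) (fun y => L (lap u y)) Ω := fun x hx => by
  simp only [lap, map_sum]
  refine Finset.sum_congr rfl fun i _ => ?_
  have h1 : Set.EqOn (pderiv i fun y => L (u y)) (fun y => L (pderiv i u y)) Ω := fun y hy =>
    pderiv_clm L (differentiableAt_of_contDiffOn hΩ hu hy) i
  rw [pderiv_congr hΩ h1 i hx,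
    pderiv_clm L (differentiableAt_of_contDiffOn hΩ (contDiffOn_pderiv hΩ hu i) hx) i]

theorem lap_const_smul (r : ℝ) (hΩ : IsOpen Ω) (hu : ContDiffOn ℝ ∞ u Ω) :
    Set.EqOn (lap fun y => r • u y) (fun y => r • lap u y) Ω :=
  lap_clm (r • ContinuousLinearMap.id ℝ E) hΩ hu

theorem lap_sum {ι : Type*} {s : Finset ι} {w : ι → (Fin m → ℝ) → E} (hΩ : IsOpen Ω)
    (hw : ∀ a ∈ s, ContDiffOn ℝ ∞ (w a) Ω) :
    Set.EqOn (lap fun y => ∑ a ∈ s, w a y) (fun y => ∑ a ∈ s, lap (w a) y) Ω := fun x hx => by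
  simp only [lap]
  rw [Finset.sum_comm]
  refine Finset.sum_congr rfl fun i _ => ?_
  have h1 : Set.EqOn (pderiv i fun y => ∑ a ∈ s, w a y) (fun y => ∑ a ∈ s, pderiv i (w a) y) Ω :=
    fun y hy => pderiv_sum (fun a ha => differentiableAt_of_contDiffOn hΩ (hw a ha) hy) i
  rw [pderiv_congr hΩ h1 i hx, pderiv_sum (fun a ha =>
    differentiableAt_of_contDiffOn hΩ (contDiffOn_pderiv hΩ (hw a ha) i) hx) i]

theorem lap_add (hΩ : IsOpen Ω) (hu : ContDiffOn ℝ ∞ u Ω) (hv : ContDiffOn ℝ ∞ v Ω) :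
    Set.EqOn (lap fun y => u y + v y) (fun y => lap u y + lap v y) Ω := by
  simpa [Fin.sum_univ_two] using lap_sum (s := Finset.univ) (w := ![u, v]) hΩ (fun a _ => by
    fin_cases a <;> assumption)

theorem contDiffOn_coord (i : Fin m) : ContDiffOn ℝ ∞ (fun y : Fin m → ℝ => y i) Ω :=
  (contDiff_apply ℝ ℝ i).contDiffOn

theorem contDiffOn_coord_smul (hu : ContDiffOn ℝ ∞ u Ω) (i : Fin m) :
    ContDiffOn ℝ ∞ (fun y => y i • u y) Ω :=
  (contDiffOn_coord i).smul hu

theorem contDiffOn_const_smul (r : ℝ) (hu : ContDiffOn ℝ ∞ u Ω) :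
    ContDiffOn ℝ ∞ (fun y => r • u y) Ω :=
  contDiffOn_const.smul hu

theorem differentiableAt_coord (i : Fin m) (x : Fin m → ℝ) :
    DifferentiableAt ℝ (fun y : Fin m → ℝ => y i) x :=
  differentiableAt_apply i x

theorem lap_coord_smul (hΩ : IsOpen Ω) (hu : ContDiffOn ℝ ∞ u Ω) (i : Fin m) :
    Set.EqOn (lap fun y => y i • u y) (fun y => y i • lap u y + (2 : ℝ) • pderiv i u y) Ω := by
  intro x hx
  have h1 : ∀ j, pderiv j (pderiv j fun y => y i • u y) x
      = x i • pderiv j (pderiv j u) x + (2 : ℝ) • if i = j then pderiv j u x else 0 := by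
    intro j
    have h : Set.EqOn (pderiv j fun y => y i • u y)
        (fun y => y i • pderiv j u y + (if i = j then (1 : ℝ) else 0) • u y) Ω := fun y hy => by
      rw [pderiv_smul (differentiableAt_coord i y) (differentiableAt_of_contDiffOn hΩ hu hy),
        pderiv_coord]
    have d0 := differentiableAt_of_contDiffOn hΩ hu hx
    have d1 := differentiableAt_of_contDiffOn hΩ (contDiffOn_pderiv hΩ hu j) hx
    rw [pderiv_congr hΩ h j hx,
      pderiv_add ((differentiableAt_coord i x).fun_smul d1) (d0.fun_const_smul _),
      pderiv_smul (differentiableAt_coord i x) d1, pderiv_const_smul _ d0, pderiv_coord]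
    split_ifs <;> module
  simp only [lap, h1, Finset.sum_add_distrib, ← Finset.smul_sum, Finset.sum_ite_eq,
    Finset.mem_univ, if_true]

theorem pderiv_lap (hΩ : IsOpen Ω) (hu : ContDiffOn ℝ ∞ u Ω) (i : Fin m) :
    Set.EqOn (pderiv i (lap u)) (lap (pderiv i u)) Ω := fun x hx => by
  change pderiv i (fun y => ∑ j, pderiv j (pderiv j u) y) x = _
  have hs := fun j => contDiffOn_pderiv hΩ hu j
  rw [pderiv_sum (fun j _ => differentiableAt_of_contDiffOn hΩ (contDiffOn_pderiv hΩ (hs j) j) hx)]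
  refine Finset.sum_congr rfl fun j _ => ?_
  rw [pderiv_comm hΩ (hs j) i j hx]
  exact pderiv_congr hΩ (pderiv_comm hΩ hu i j) j hx

/-! ### Iterated Laplacians -/

theorem lapIter_congr (hΩ : IsOpen Ω) (h : Set.EqOn u v Ω) (j : ℕ) :
    Set.EqOn (lap^[j] u) (lap^[j] v) Ω := by
  induction j generalizing u v with
  | zero => exact h
  | succ j ih => exact ih (lap_congr hΩ h)

theorem contDiffOn_lapIter (hΩ : IsOpen Ω) (hu : ContDiffOn ℝ ∞ u Ω) (j : ℕ) :
    ContDiffOn ℝ ∞ (lap^[j] u) Ω := by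
  induction j generalizing u with
  | zero => exact hu
  | succ j ih => exact ih (contDiffOn_lap hΩ hu)

theorem lapIter_clm (L : E →L[ℝ] G) (hΩ : IsOpen Ω) (hu : ContDiffOn ℝ ∞ u Ω) (j : ℕ) :
    Set.EqOn (lap^[j] fun y => L (u y)) (fun y => L (lap^[j] u y)) Ω := by
  induction j generalizing u with
  | zero => exact fun _ _ => rfl
  | succ j ih =>
    exact (lapIter_congr hΩ (lap_clm L hΩ hu) j).trans (ih (contDiffOn_lap hΩ hu))

theorem lapIter_const_smul (r : ℝ) (hΩ : IsOpen Ω) (hu : ContDiffOn ℝ ∞ u Ω) (j : ℕ) :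
    Set.EqOn (lap^[j] fun y => r • u y) (fun y => r • lap^[j] u y) Ω :=
  lapIter_clm (r • ContinuousLinearMap.id ℝ E) hΩ hu j

theorem lapIter_add (hΩ : IsOpen Ω) (hu : ContDiffOn ℝ ∞ u Ω) (hv : ContDiffOn ℝ ∞ v Ω) (j : ℕ) :
    Set.EqOn (lap^[j] fun y => u y + v y) (fun y => lap^[j] u y + lap^[j] v y) Ω := by
  induction j generalizing u v with
  | zero => exact fun _ _ => rfl
  | succ j ih =>
    exact (lapIter_congr hΩ (lap_add hΩ hu hv) j).trans
      (ih (contDiffOn_lap hΩ hu) (contDiffOn_lap hΩ hv))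

theorem lapIter_sum {ι : Type*} {s : Finset ι} {w : ι → (Fin m → ℝ) → E} (hΩ : IsOpen Ω)
    (hw : ∀ a ∈ s, ContDiffOn ℝ ∞ (w a) Ω) (j : ℕ) :
    Set.EqOn (lap^[j] fun y => ∑ a ∈ s, w a y) (fun y => ∑ a ∈ s, lap^[j] (w a) y) Ω := by
  induction j generalizing w with
  | zero => exact fun _ _ => rfl
  | succ j ih =>
    exact (lapIter_congr hΩ (lap_sum hΩ hw) j).trans (ih fun a ha => contDiffOn_lap hΩ (hw a ha))

theorem lapIter_coord_smul (hΩ : IsOpen Ω) (hu : ContDiffOn ℝ ∞ u Ω) (i : Fin m) (j : ℕ) :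
    Set.EqOn (lap^[j + 1] fun y => y i • u y)
      (fun y => y i • lap^[j + 1] u y + (2 * (j + 1) : ℝ) • pderiv i (lap^[j] u) y) Ω := by
  induction j with
  | zero => simpa using lap_coord_smul hΩ hu i
  | succ j ih =>
    intro x hx
    have s1 := contDiffOn_lapIter hΩ hu (j + 1)
    have s2 := contDiffOn_pderiv hΩ (contDiffOn_lapIter hΩ hu j) i
    rw [Function.iterate_succ_apply', lap_congr hΩ ih hx,
      lap_add hΩ (contDiffOn_coord_smul s1 i) (contDiffOn_const_smul _ s2) hx]
    simp only []
    rw [lap_coord_smul hΩ s1 i hx, lap_const_smul _ hΩ s2 hx]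
    simp only []
    rw [← pderiv_lap hΩ (contDiffOn_lapIter hΩ hu j) i hx,
      ← Function.iterate_succ_apply' lap (j + 1) u, ← Function.iterate_succ_apply' lap j u]
    push_cast
    module

end Analysis
end Cl

namespace Cl

/-! ### Polyharmonic functions and the Kelvin transform -/

section Kelvin

open scoped ContDiff

variable {E : Type*} [NormedAddCommGroup E] [NormedSpace ℝ E] {m : ℕ} {Ω : Set (Fin m → ℝ)}
  {u : (Fin m → ℝ) → E}

/-- The Euler operator `Σ xᵢ ∂ᵢ`. -/
def euler (u : (Fin m → ℝ) → E) (x : Fin m → ℝ) : E := ∑ i, x i • pderiv i u x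

theorem contDiffOn_euler (hΩ : IsOpen Ω) (hu : ContDiffOn ℝ ∞ u Ω) :
    ContDiffOn ℝ ∞ (euler u) Ω :=
  ContDiffOn.sum fun i _ => contDiffOn_coord_smul (contDiffOn_pderiv hΩ hu i) i

theorem lap_euler (hΩ : IsOpen Ω) (hu : ContDiffOn ℝ ∞ u Ω) :
    Set.EqOn (lap (euler u)) (fun y => euler (lap u) y + (2 : ℝ) • lap u y) Ω := fun x hx => by
  have hs := fun i => contDiffOn_pderiv hΩ hu i
  change lap (fun y => ∑ i, y i • pderiv i u y) x = _
  rw [lap_sum hΩ (fun i _ => contDiffOn_coord_smul (hs i) i) hx]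
  simp only [euler]
  rw [Finset.sum_congr rfl fun i _ => lap_coord_smul hΩ (hs i) i hx, Finset.sum_add_distrib,
    ← Finset.smul_sum]
  congr 1
  exact Finset.sum_congr rfl fun i _ => by rw [pderiv_lap hΩ hu i hx]

theorem contDiff_dot_self : ContDiff ℝ ∞ fun y : Fin m → ℝ => y ⬝ᵥ y :=
  ContDiff.sum fun i _ => (contDiff_apply ℝ ℝ i).mul (contDiff_apply ℝ ℝ i)

theorem lap_dot_smul (hΩ : IsOpen Ω) (hu : ContDiffOn ℝ ∞ u Ω) :
    Set.EqOn (lap fun y => (y ⬝ᵥ y) • u y)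
      (fun y => (y ⬝ᵥ y) • lap u y + (4 : ℝ) • euler u y + (2 * m : ℝ) • u y) Ω := fun x hx => by
  have h1 : (fun y : Fin m → ℝ => (y ⬝ᵥ y) • u y) = fun y => ∑ i, y i • y i • u y := by
    funext y; simp only [dotProduct, Finset.sum_smul, smul_smul]
  rw [h1, lap_sum hΩ (fun i _ => contDiffOn_coord_smul (contDiffOn_coord_smul hu i) i) hx]
  have h2 : ∀ i, lap (fun y => y i • y i • u y) x
      = (x i * x i) • lap u x + (4 : ℝ) • x i • pderiv i u x + (2 : ℝ) • u x := fun i => by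
    rw [lap_coord_smul hΩ (contDiffOn_coord_smul hu i) i hx]
    simp only []
    rw [lap_coord_smul hΩ hu i hx, pderiv_smul (differentiableAt_coord i x)
      (differentiableAt_of_contDiffOn hΩ hu hx), pderiv_coord, if_pos rfl]
    module
  simp only [h2, Finset.sum_add_distrib, ← Finset.smul_sum, ← Finset.sum_smul, dotProduct, euler,
    Finset.sum_const, Finset.card_univ, Fintype.card_fin]
  rw [← Nat.cast_smul_eq_nsmul ℝ]
  module

/-- The first order operator in the commutation of Laplacian and inversion. -/
def eulerShift (t : ℝ) (u : (Fin m → ℝ) → E) (y : Fin m → ℝ) : E :=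
  t • u y - (2 : ℝ) • euler u y

theorem contDiffOn_eulerShift (t : ℝ) (hΩ : IsOpen Ω) (hu : ContDiffOn ℝ ∞ u Ω) :
    ContDiffOn ℝ ∞ (eulerShift t u) Ω :=
  (contDiffOn_const_smul t hu).sub (contDiffOn_const_smul 2 (contDiffOn_euler hΩ hu))

/-- The second order operator with `Δ T_{j+1} = T_j (kelvinOp j)`, where `T_j` denotes the
Kelvin transform preserving `j`-harmonic functions. -/
def kelvinOp (j : ℝ) (u : (Fin m → ℝ) → E) (y : Fin m → ℝ) : E :=
  (y ⬝ᵥ y) • lap u y + (2 * j) • eulerShift (2 * j + 2 - m) u y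

theorem contDiffOn_kelvinOp (j : ℝ) (hΩ : IsOpen Ω) (hu : ContDiffOn ℝ ∞ u Ω) :
    ContDiffOn ℝ ∞ (kelvinOp j u) Ω :=
  (contDiff_dot_self.contDiffOn.smul (contDiffOn_lap hΩ hu)).add
    (contDiffOn_const_smul _ (contDiffOn_eulerShift _ hΩ hu))

theorem lap_kelvinOp (j : ℝ) (hΩ : IsOpen Ω) (hu : ContDiffOn ℝ ∞ u Ω) :
    Set.EqOn (lap (kelvinOp j u)) (kelvinOp (j - 1) (lap u)) Ω := fun x hx => by
  have h : kelvinOp j u = fun y => ((y ⬝ᵥ y) • lap u y + (2 * j * (2 * j + 2 - m)) • u y)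
      + (-(4 * j)) • euler u y := by
    funext y; simp only [kelvinOp, eulerShift]; module
  have s1 := contDiffOn_lap hΩ hu
  have s2 := contDiffOn_euler hΩ hu
  have s3 : ContDiffOn ℝ ∞ (fun y => (y ⬝ᵥ y) • lap u y) Ω := contDiff_dot_self.contDiffOn.smul s1
  rw [h, lap_add hΩ (s3.add (contDiffOn_const_smul _ hu)) (contDiffOn_const_smul _ s2) hx]
  simp only []
  rw [lap_add hΩ s3 (contDiffOn_const_smul _ hu) hx]
  simp only []
  rw [lap_dot_smul hΩ s1 hx, lap_const_smul _ hΩ hu hx, lap_const_smul _ hΩ s2 hx]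
  simp only []
  rw [lap_euler hΩ hu hx]
  simp only [kelvinOp, eulerShift]
  module

theorem lapIter_kelvinOp (j : ℝ) (hΩ : IsOpen Ω) (hu : ContDiffOn ℝ ∞ u Ω) (M : ℕ) :
    Set.EqOn (lap^[M] (kelvinOp j u)) (kelvinOp (j - M) (lap^[M] u)) Ω := by
  induction M generalizing u j with
  | zero => intro x _; simp
  | succ M ih =>
    refine (lapIter_congr hΩ (lap_kelvinOp j hΩ hu) M).trans ?_
    have h := ih (j - 1) (contDiffOn_lap hΩ hu)
    rwa [show j - 1 - (M : ℝ) = j - (M + 1 : ℕ) by push_cast; ring] at h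

/-- The inversion in the unit sphere. -/
def inversion (x : Fin m → ℝ) : Fin m → ℝ := (x ⬝ᵥ x)⁻¹ • x

/-- The Kelvin transform of weight `t`. -/
def kelvin (t : ℝ) (u : (Fin m → ℝ) → E) (x : Fin m → ℝ) : E := (x ⬝ᵥ x) ^ t • u (inversion x)

theorem dot_self_pos {x : Fin m → ℝ} (hx : x ≠ 0) : 0 < x ⬝ᵥ x :=
  lt_of_le_of_ne (Finset.sum_nonneg fun i _ => mul_self_nonneg _)
    (Ne.symm (by simpa [dotProduct_self_eq_zero] using hx))

theorem contDiffOn_inversion : ContDiffOn ℝ ∞ (inversion : (Fin m → ℝ) → _) {0}ᶜ :=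
  (contDiff_dot_self.contDiffOn.inv fun _ hx => (dot_self_pos hx).ne').smul contDiffOn_id

theorem isOpen_inversion_preimage (hΩ : IsOpen Ω) :
    IsOpen ({0}ᶜ ∩ inversion ⁻¹' Ω : Set (Fin m → ℝ)) :=
  contDiffOn_inversion.continuousOn.isOpen_inter_preimage isOpen_compl_singleton hΩ

theorem contDiffOn_kelvin (t : ℝ) (hu : ContDiffOn ℝ ∞ u Ω) :
    ContDiffOn ℝ ∞ (kelvin t u) ({0}ᶜ ∩ inversion ⁻¹' Ω) :=
  (contDiff_dot_self.contDiffOn.rpow_const_of_ne fun _ hx => (dot_self_pos hx.1).ne').smul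
    (hu.comp (contDiffOn_inversion.mono Set.inter_subset_left) fun _ hx => hx.2)

theorem pderiv_dot_self_rpow (t : ℝ) {x : Fin m → ℝ} (hx : x ≠ 0) (i : Fin m) :
    pderiv i (fun y => (y ⬝ᵥ y) ^ t) x = 2 * t * (x ⬝ᵥ x) ^ (t - 1) * x i := by
  have hd : DifferentiableAt ℝ (fun y : Fin m → ℝ => y ⬝ᵥ y) x :=
    contDiff_dot_self.differentiable (by simp) x
  have h1 : pderiv i (fun y : Fin m → ℝ => y ⬝ᵥ y) x = 2 * x i := by
    have h2 : ∀ j, pderiv i (fun y : Fin m → ℝ => y j * y j) x = if j = i then 2 * x j else 0 := by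
      intro j
      have := pderiv_smul (differentiableAt_coord j x) (differentiableAt_coord j x) i
      simp only [smul_eq_mul, pderiv_coord] at this
      rw [this]
      split_ifs <;> ring
    simp only [dotProduct]
    rw [pderiv_sum fun j _ => (differentiableAt_coord j x).fun_mul (differentiableAt_coord j x)]
    simp [h2]
  unfold pderiv at h1 ⊢
  rw [(hd.hasFDerivAt.rpow_const (Or.inl (dot_self_pos hx).ne')).fderiv,
    FunLike.coe_smul, Pi.smul_apply, h1, smul_eq_mul]
  ring

theorem pderiv_comp_inversion {x : Fin m → ℝ} (hx : x ≠ 0)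
    (hu : DifferentiableAt ℝ u (inversion x)) (i : Fin m) :
    pderiv i (fun y => u (inversion y)) x
      = (x ⬝ᵥ x)⁻¹ • (pderiv i u (inversion x) - (2 * x i) • euler u (inversion x)) := by
  have hq := dot_self_pos hx
  have hdq : DifferentiableAt ℝ (fun y : Fin m → ℝ => (y ⬝ᵥ y) ^ (-1 : ℝ)) x :=
    (contDiff_dot_self.differentiable (by simp) x).rpow_const (Or.inl hq.ne')
  have hinv : ∀ (y : Fin m → ℝ) j, inversion y j = (y ⬝ᵥ y) ^ (-1 : ℝ) • y j := fun y j => by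
    rw [Real.rpow_neg_one]; rfl
  have h1 : ∀ j, pderiv i (fun y => inversion y j) x
      = (x ⬝ᵥ x)⁻¹ * ((if j = i then 1 else 0) - 2 * x i * inversion x j) := fun j => by
    simp only [hinv]
    rw [pderiv_smul hdq (differentiableAt_coord j x), pderiv_dot_self_rpow _ hx, pderiv_coord,
      Real.rpow_sub hq, Real.rpow_neg_one, Real.rpow_one]
    simp only [smul_eq_mul]
    field_simp
    ring
  have h2 : ∀ j, DifferentiableAt ℝ (fun y => inversion y j) x := fun j => by
    simp only [hinv]
    exact hdq.smul (differentiableAt_coord j x)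
  rw [pderiv_comp hu h2]
  simp only [h1, mul_smul, ← Finset.smul_sum, sub_smul, Finset.sum_sub_distrib, ite_smul, one_smul,
    zero_smul, Finset.sum_ite_eq', Finset.mem_univ, if_true, euler]

theorem pderiv_kelvin (t : ℝ) (hΩ : IsOpen Ω) (hu : ContDiffOn ℝ ∞ u Ω) (i : Fin m) :
    Set.EqOn (pderiv i (kelvin t u))
      (fun x => kelvin (t - 1) (pderiv i u) x + x i • kelvin (t - 1) (eulerShift (2 * t) u) x)
      ({0}ᶜ ∩ inversion ⁻¹' Ω) := fun x hx => by
  have hq := dot_self_pos hx.1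
  have hdq : DifferentiableAt ℝ (fun y : Fin m → ℝ => (y ⬝ᵥ y) ^ t) x :=
    (contDiff_dot_self.differentiable (by simp) x).rpow_const (Or.inl hq.ne')
  have hdu : DifferentiableAt ℝ (fun y => u (inversion y)) x :=
    differentiableAt_of_contDiffOn (isOpen_inversion_preimage hΩ)
      (hu.comp (contDiffOn_inversion.mono Set.inter_subset_left) fun _ hx => hx.2) hx
  change pderiv i (fun y => (y ⬝ᵥ y) ^ t • u (inversion y)) x = _
  rw [pderiv_smul hdq hdu, pderiv_comp_inversion hx.1 (differentiableAt_of_contDiffOn hΩ hu hx.2),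
    pderiv_dot_self_rpow _ hx.1]
  have h : (x ⬝ᵥ x) ^ t = (x ⬝ᵥ x) ^ (t - 1) * (x ⬝ᵥ x) := by
    rw [Real.rpow_sub_one hq.ne']; field_simp
  have h' : (x ⬝ᵥ x) ^ t * (x ⬝ᵥ x)⁻¹ = (x ⬝ᵥ x) ^ (t - 1) := by
    rw [h]; field_simp
  rw [smul_smul, h']
  simp only [kelvin, eulerShift]
  module

theorem sum_smul_eulerShift_pderiv (t : ℝ) (hΩ : IsOpen Ω) (hu : ContDiffOn ℝ ∞ u Ω) :
    Set.EqOn (fun y => ∑ i, y i • eulerShift t (pderiv i u) y)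
      (euler (eulerShift (t + 2) u)) Ω := fun y hy => by
  have s0 := differentiableAt_of_contDiffOn hΩ hu hy
  have s1 := fun i => differentiableAt_of_contDiffOn hΩ (contDiffOn_pderiv hΩ hu i) hy
  have s2 := differentiableAt_of_contDiffOn hΩ (contDiffOn_euler hΩ hu) hy
  have h1 : ∀ i, pderiv i (euler u) y = euler (pderiv i u) y + pderiv i u y := fun i => by
    change pderiv i (fun z => ∑ j, z j • pderiv j u z) y = _
    rw [pderiv_sum fun j _ => (differentiableAt_coord j y).fun_smul (s1 j)]
    rw [Finset.sum_congr rfl fun j _ => pderiv_smul (differentiableAt_coord j y) (s1 j) i]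
    simp only [Finset.sum_add_distrib, pderiv_coord, ite_smul, one_smul, zero_smul,
      Finset.sum_ite_eq', Finset.mem_univ, if_true, euler]
    congr 1
    exact Finset.sum_congr rfl fun j _ => by rw [pderiv_comm hΩ hu i j hy]
  have h2 : ∀ i, pderiv i (eulerShift (t + 2) u) y
      = (t + 2) • pderiv i u y - (2 : ℝ) • (euler (pderiv i u) y + pderiv i u y) := fun i => by
    change pderiv i (fun z => (t + 2) • u z - (2 : ℝ) • euler u z) y = _
    rw [pderiv_sub (s0.fun_const_smul _) (s2.fun_const_smul _), pderiv_const_smul _ s0,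
      pderiv_const_smul _ s2, h1]
  rw [euler]
  refine Finset.sum_congr rfl fun i _ => ?_
  rw [h2, eulerShift]
  module

theorem lap_kelvin (j : ℝ) (hΩ : IsOpen Ω) (hu : ContDiffOn ℝ ∞ u Ω) :
    Set.EqOn (lap (kelvin (j + 1 - m / 2) u)) (kelvin (j - m / 2) (kelvinOp j u))
      ({0}ᶜ ∩ inversion ⁻¹' Ω) := fun x hx => by
  have hΩ' := isOpen_inversion_preimage hΩ
  have hq := dot_self_pos hx.1
  obtain ⟨t, ht⟩ : ∃ t : ℝ, t = j + 1 - m / 2 := ⟨_, rfl⟩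
  rw [show j - (m / 2 : ℝ) = t - 1 by rw [ht]; ring, ← ht]
  have hW := contDiffOn_eulerShift (2 * t) hΩ hu
  have h1 : ∀ i, pderiv i (pderiv i (kelvin t u)) x = (x ⬝ᵥ x) ^ (t - 2) •
      (pderiv i (pderiv i u) (inversion x)
        + x i • eulerShift (2 * t - 2) (pderiv i u) (inversion x)
        + (x ⬝ᵥ x) • eulerShift (2 * t) u (inversion x)
        + x i • pderiv i (eulerShift (2 * t) u) (inversion x)
        + (x i * x i) • eulerShift (2 * t - 2) (eulerShift (2 * t) u) (inversion x)) := fun i => by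
    have hs := contDiffOn_pderiv hΩ hu i
    have d1 := differentiableAt_of_contDiffOn hΩ' (contDiffOn_kelvin (t - 1) hs) hx
    have d2 := differentiableAt_of_contDiffOn hΩ' (contDiffOn_kelvin (t - 1) hW) hx
    rw [pderiv_congr hΩ' (pderiv_kelvin t hΩ hu i) i hx,
      pderiv_add d1 ((differentiableAt_coord i x).fun_smul d2),
      pderiv_smul (differentiableAt_coord i x) d2, pderiv_coord, if_pos rfl,
      pderiv_kelvin _ hΩ hs i hx, pderiv_kelvin _ hΩ hW i hx]
    simp only [kelvin]
    have e1 : t - 1 - 1 = t - 2 := by ring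
    have e2 : (x ⬝ᵥ x) ^ (t - 1) = (x ⬝ᵥ x) ^ (t - 2) * (x ⬝ᵥ x) := by
      rw [← e1, Real.rpow_sub_one hq.ne' (t - 1)]; field_simp
    rw [e1, e2, show 2 * (t - 1) = 2 * t - 2 by ring]
    module
  have h2 : ∀ g : Fin m → E, ∑ i, x i • g i = (x ⬝ᵥ x) • ∑ i, inversion x i • g i := fun g => by
    rw [Finset.smul_sum]
    refine Finset.sum_congr rfl fun i _ => ?_
    rw [smul_smul, inversion, Pi.smul_apply, smul_eq_mul, mul_inv_cancel_left₀ hq.ne']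
  have h3 : (x ⬝ᵥ x) * (inversion x ⬝ᵥ inversion x) = 1 := by
    simp only [inversion, smul_dotProduct, dotProduct_smul, smul_eq_mul]
    field_simp
  have e2 : (x ⬝ᵥ x) ^ (t - 1) = (x ⬝ᵥ x) ^ (t - 2) * (x ⬝ᵥ x) := by
    rw [show t - 2 = t - 1 - 1 by ring, Real.rpow_sub_one hq.ne' (t - 1)]; field_simp
  have h4 := sum_smul_eulerShift_pderiv (2 * t - 2) hΩ hu hx.2
  rw [sub_add_cancel] at h4
  simp only at h4
  rw [lap, Finset.sum_congr rfl fun i _ => h1 i, ← Finset.smul_sum]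
  simp only [Finset.sum_add_distrib, h2, h4, ← Finset.sum_smul]
  rw [kelvin, e2, mul_smul]
  congr 1
  change lap u (inversion x) + _ + _ + (x ⬝ᵥ x) • euler (eulerShift (2 * t) u) (inversion x)
    + (x ⬝ᵥ x) • _ = _
  rw [kelvinOp, smul_add, smul_smul, h3, one_smul, Finset.sum_const, Finset.card_univ,
    Fintype.card_fin, ← Nat.cast_smul_eq_nsmul ℝ, show 2 * j + 2 - (m : ℝ) = 2 * t by rw [ht]; ring,
    show 2 * j = 2 * t - 2 + m by rw [ht]; ring,
    show eulerShift (2 * t - 2) (eulerShift (2 * t) u) (inversion x)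
      = (2 * t - 2) • eulerShift (2 * t) u (inversion x)
        - (2 : ℝ) • euler (eulerShift (2 * t) u) (inversion x) from rfl]
  module

/-- The Kelvin transform of weight `M - m / 2` preserves `M`-harmonic functions. -/
theorem lapIter_kelvin_eq_zero (M : ℕ) (hΩ : IsOpen Ω) (hu : ContDiffOn ℝ ∞ u Ω)
    (h0 : Set.EqOn (lap^[M] u) 0 Ω) :
    Set.EqOn (lap^[M] (kelvin (M - m / 2 : ℝ) u)) 0 ({0}ᶜ ∩ inversion ⁻¹' Ω) := by
  induction M generalizing u with
  | zero => intro x hx; simp [kelvin, show u (inversion x) = 0 from h0 hx.2]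
  | succ M ih =>
    have h := lap_kelvin M hΩ hu
    rw [show (M : ℝ) + 1 - m / 2 = ((M + 1 : ℕ) : ℝ) - m / 2 by push_cast; ring] at h
    refine (lapIter_congr (isOpen_inversion_preimage hΩ) h M).trans
      (ih (contDiffOn_kelvinOp _ hΩ hu) fun x hx => ?_)
    rw [lapIter_kelvinOp _ hΩ hu M hx]
    have h1 : lap (lap^[M] u) x = 0 := by
      rw [← Function.iterate_succ_apply' lap M u]; exact h0 hx
    simp [kelvinOp, h1]

/-! ### Conformal affine maps -/

/-- Precomposition with a conformal affine map preserves polyharmonic functions. -/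
theorem lapIter_comp_affine_eq_zero (H : Matrix (Fin m) (Fin m) ℝ) (r : ℝ)
    (hH : H * H.transpose = r • 1) (α : Fin m → ℝ) (M : ℕ) (hΩ : IsOpen Ω)
    (hu : ContDiffOn ℝ ∞ u Ω) (h0 : Set.EqOn (lap^[M] u) 0 Ω) :
    Set.EqOn (lap^[M] fun x => u (α + H.mulVec x)) 0 ((fun x => α + H.mulVec x) ⁻¹' Ω) := by
  have hA : ContDiff ℝ ∞ fun x => α + H.mulVec x :=
    contDiff_const.add (LinearMap.toContinuousLinearMap H.mulVecLin).contDiff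
  have hΩ' : IsOpen ((fun x => α + H.mulVec x) ⁻¹' Ω) := hΩ.preimage hA.continuous
  have hp : ∀ {w : (Fin m → ℝ) → E} (_ : ContDiffOn ℝ ∞ w Ω) (i : Fin m),
      Set.EqOn (pderiv i fun x => w (α + H.mulVec x))
        (fun x => ∑ j, H j i • pderiv j w (α + H.mulVec x))
        ((fun x => α + H.mulVec x) ⁻¹' Ω) := fun {w} hw i x hx => by
    rw [pderiv_comp (φ := fun x => α + H.mulVec x) (differentiableAt_of_contDiffOn hΩ hw hx)
      fun j => differentiableAt_pi.1 (hA.differentiable (by simp) x) j]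
    refine Finset.sum_congr rfl fun j _ => ?_
    congr 1
    have h1 : HasFDerivAt (fun x => α + H.mulVec x)
        (LinearMap.toContinuousLinearMap H.mulVecLin) x :=
      (LinearMap.toContinuousLinearMap H.mulVecLin).hasFDerivAt.const_add α
    rw [pderiv, ((hasFDerivAt_pi'.1 h1) j).fderiv]
    simp
  have hlap : ∀ {w : (Fin m → ℝ) → E} (_ : ContDiffOn ℝ ∞ w Ω),
      Set.EqOn (lap fun x => w (α + H.mulVec x)) (fun x => r • lap w (α + H.mulVec x))
        ((fun x => α + H.mulVec x) ⁻¹' Ω) := fun {w} hw x hx => by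
    have hs := fun j => contDiffOn_pderiv hΩ hw j
    have h2 : ∀ i, pderiv i (pderiv i fun x => w (α + H.mulVec x)) x
        = ∑ j, ∑ l, (H j i * H l i) • pderiv l (pderiv j w) (α + H.mulVec x) := fun i => by
      have hd : ∀ j, DifferentiableAt ℝ (fun x => pderiv j w (α + H.mulVec x)) x := fun j =>
        differentiableAt_of_contDiffOn hΩ' ((hs j).comp hA.contDiffOn fun _ h => h) hx
      rw [pderiv_congr hΩ' (hp hw i) i hx, pderiv_sum fun j _ => (hd j).fun_const_smul _]
      refine Finset.sum_congr rfl fun j _ => ?_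
      rw [pderiv_const_smul _ (hd j), hp (hs j) i hx, Finset.smul_sum]
      simp only [smul_smul]
    rw [lap, Finset.sum_congr rfl fun i _ => h2 i, Finset.sum_comm]
    simp only [lap, Finset.smul_sum]
    refine Finset.sum_congr rfl fun j _ => ?_
    rw [Finset.sum_comm]
    have h3 : ∀ l, ∑ i, H j i * H l i = if j = l then r else 0 := fun l => by
      have := congrFun (congrFun hH j) l
      simpa [Matrix.mul_apply, Matrix.one_apply] using this
    simp only [← Finset.sum_smul, h3, ite_smul, zero_smul, Finset.sum_ite_eq, Finset.mem_univ,
      if_true]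
  induction M generalizing u with
  | zero => exact fun x hx => h0 hx
  | succ M ih =>
    refine (lapIter_congr hΩ' (hlap hu) M).trans fun x hx => ?_
    have hs := contDiffOn_lap hΩ hu
    have hs' : ContDiffOn ℝ ∞ (fun x => lap u (α + H.mulVec x))
        ((fun x => α + H.mulVec x) ⁻¹' Ω) := hs.comp hA.contDiffOn fun _ h => h
    rw [lapIter_const_smul r hΩ' hs' M hx]
    simp only []
    rw [ih hs h0 hx]
    simp

end Kelvin
end Cl

namespace Cl

/-! ### The Dirac operator and polyharmonic functions -/

section Dirac

open scoped ContDiff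

variable {n m : ℕ}

/-- Smooth functions killed by the `M`-th power of the Laplacian. -/
def Polyharmonic {E : Type*} [NormedAddCommGroup E] [NormedSpace ℝ E] (M : ℕ)
    (u : (Fin m → ℝ) → E) (Ω : Set (Fin m → ℝ)) : Prop :=
  ContDiffOn ℝ ∞ u Ω ∧ Set.EqOn (lap^[M] u) 0 Ω

namespace Polyharmonic

variable {E : Type*} [NormedAddCommGroup E] [NormedSpace ℝ E] {M : ℕ}
  {Ω : Set (Fin m → ℝ)} {u v : (Fin m → ℝ) → E}

theorem mono {Ω' : Set (Fin m → ℝ)} (hu : Polyharmonic M u Ω) (h : Ω' ⊆ Ω) :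
    Polyharmonic M u Ω' :=
  ⟨hu.1.mono h, hu.2.mono h⟩

theorem congr (hu : Polyharmonic M u Ω) (hΩ : IsOpen Ω) (h : Set.EqOn v u Ω) :
    Polyharmonic M v Ω :=
  ⟨hu.1.congr h, (lapIter_congr hΩ h M).trans hu.2⟩

theorem add (hu : Polyharmonic M u Ω) (hv : Polyharmonic M v Ω) (hΩ : IsOpen Ω) :
    Polyharmonic M (fun x => u x + v x) Ω :=
  ⟨hu.1.add hv.1, fun x hx => by rw [lapIter_add hΩ hu.1 hv.1 M hx]; simp [hu.2 hx, hv.2 hx]⟩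

theorem comp_affine (hu : Polyharmonic M u Ω) (hΩ : IsOpen Ω) {H : Matrix (Fin m) (Fin m) ℝ}
    {r : ℝ} (hH : H * H.transpose = r • 1) (α : Fin m → ℝ) :
    Polyharmonic M (fun x => u (α + H.mulVec x)) ((fun x => α + H.mulVec x) ⁻¹' Ω) :=
  ⟨hu.1.comp (contDiff_const.add (LinearMap.toContinuousLinearMap H.mulVecLin).contDiff).contDiffOn
    fun _ h => h, lapIter_comp_affine_eq_zero H r hH α M hΩ hu.1 hu.2⟩

theorem kelvin (hu : Polyharmonic M u Ω) (hΩ : IsOpen Ω) :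
    Polyharmonic M (kelvin (M - m / 2 : ℝ) u) ({0}ᶜ ∩ inversion ⁻¹' Ω) :=
  ⟨contDiffOn_kelvin _ hu.1, lapIter_kelvin_eq_zero M hΩ hu.1 hu.2⟩

/-- Composition with a Möbius transformation `x ↦ α + H ((x + δ) / |x + δ|²)`, with the conformal
weight, preserves polyharmonic functions. -/
theorem comp_inversion (hu : Polyharmonic M u Ω) (hΩ : IsOpen Ω) {H : Matrix (Fin m) (Fin m) ℝ}
    {r : ℝ} (hH : H * H.transpose = r • 1) (α δ : Fin m → ℝ) :
    Polyharmonic M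
      (fun x => ((x + δ) ⬝ᵥ (x + δ)) ^ (M - m / 2 : ℝ) • u (α + H.mulVec (inversion (x + δ))))
      {x | x + δ ≠ 0 ∧ α + H.mulVec (inversion (x + δ)) ∈ Ω} := by
  have hΩ' : IsOpen ((fun x => α + H.mulVec x) ⁻¹' Ω) := hΩ.preimage
    (contDiff_const.add (LinearMap.toContinuousLinearMap H.mulVecLin).contDiff (n := ∞)).continuous
  have h := ((hu.comp_affine hΩ hH α).kelvin hΩ').comp_affine (isOpen_inversion_preimage hΩ')
    (H := 1) (r := 1) (by simp) δ
  simp only [Matrix.one_mulVec, add_comm δ] at h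
  exact h

end Polyharmonic

variable {Ω : Set (Fin (n + 1) → ℝ)} {u v : (Fin (n + 1) → ℝ) → Cl n}

/-- Left multiplication as a continuous linear map. -/
def mulLeftL (a : Cl n) : Cl n →L[ℝ] Cl n :=
  LinearMap.toContinuousLinearMap (LinearMap.mulLeft ℝ a)

theorem contDiffOn_mul_left (a : Cl n) (hu : ContDiffOn ℝ ∞ u Ω) :
    ContDiffOn ℝ ∞ (fun y => a * u y) Ω :=
  (mulLeftL a).contDiff.comp_contDiffOn hu

theorem lapIter_mul_left (a : Cl n) (hΩ : IsOpen Ω) (hu : ContDiffOn ℝ ∞ u Ω) (j : ℕ) :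
    Set.EqOn (lap^[j] fun y => a * u y) (fun y => a * lap^[j] u y) Ω :=
  lapIter_clm (mulLeftL a) hΩ hu j

theorem pderiv_mul_left (a : Cl n) {x : Fin (n + 1) → ℝ} (hu : DifferentiableAt ℝ u x)
    (i : Fin (n + 1)) : pderiv i (fun y => a * u y) x = a * pderiv i u x :=
  pderiv_clm (mulLeftL a) hu i

theorem Polyharmonic.mul_left {M : ℕ} (hu : Polyharmonic M u Ω) (hΩ : IsOpen Ω) (a : Cl n) :
    Polyharmonic M (fun x => a * u x) Ω :=
  ⟨contDiffOn_mul_left a hu.1, (lapIter_mul_left a hΩ hu.1 M).trans fun x hx => by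
    simp only [hu.2 hx, Pi.zero_apply, mul_zero]⟩

theorem dirac_eq_sum (u : (Fin (n + 1) → ℝ) → Cl n) (x : Fin (n + 1) → ℝ) :
    dirac u x = ∑ i, basisPara i * pderiv i u x := by
  rw [Fin.sum_univ_succ]
  exact congrArg (· + _) (one_mul _).symm

theorem para_mul_eq_sum (x : Fin (n + 1) → ℝ) (a : Cl n) :
    para x * a = ∑ i, x i • (basisPara i * a) := by
  rw [para_eq_sum, Finset.sum_mul]
  exact Finset.sum_congr rfl fun i _ => smul_mul_assoc _ _ _

theorem contDiffOn_para_mul (hu : ContDiffOn ℝ ∞ u Ω) :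
    ContDiffOn ℝ ∞ (fun y => para y * u y) Ω := by
  simp only [para_mul_eq_sum]
  exact ContDiffOn.sum fun i _ => contDiffOn_coord_smul (contDiffOn_mul_left _ hu) i

theorem lapIter_para_mul (hΩ : IsOpen Ω) (hu : ContDiffOn ℝ ∞ u Ω) (j : ℕ) :
    Set.EqOn (lap^[j + 1] fun y => para y * u y)
      (fun y => para y * lap^[j + 1] u y + (2 * (j + 1) : ℝ) • dirac (lap^[j] u) y) Ω := by
  intro x hx
  have hs := fun i : Fin (n + 1) => contDiffOn_mul_left (basisPara i) hu
  simp only [para_mul_eq_sum, dirac_eq_sum]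
  rw [lapIter_sum hΩ (fun i _ => contDiffOn_coord_smul (hs i) i) (j + 1) hx]
  simp only []
  rw [Finset.smul_sum, ← Finset.sum_add_distrib]
  refine Finset.sum_congr rfl fun i _ => ?_
  rw [lapIter_coord_smul hΩ (hs i) i j hx]
  simp only []
  rw [lapIter_mul_left _ hΩ hu (j + 1) hx, pderiv_congr hΩ (lapIter_mul_left _ hΩ hu j) i hx,
    pderiv_mul_left _ (differentiableAt_of_contDiffOn hΩ (contDiffOn_lapIter hΩ hu j) hx)]

theorem conj_para_mul_para_add (x y : Fin (n + 1) → ℝ) :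
    conj (para x) * para y + conj (para y) * para x = (2 * (x ⬝ᵥ y)) • 1 := by
  have h := conj_mul_para (x + y)
  rw [para_add, conj_add, add_mul, mul_add, mul_add, conj_mul_para, conj_mul_para, add_dotProduct,
    dotProduct_add, dotProduct_add, dotProduct_comm y x, add_smul, add_smul, add_smul] at h
  rw [two_mul, add_smul]
  linear_combination (norm := module) h

theorem basisPara_eq (i : Fin (n + 1)) : basisPara i = para (Pi.single i 1 : Fin (n + 1) → ℝ) := by
  rw [para_eq_sum, Finset.sum_eq_single i]
  · rw [Pi.single_eq_same, one_smul]
  · intro j _ hj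
    rw [Pi.single_eq_of_ne hj, zero_smul]
  · simp

theorem conj_basisPara_mul_add (i j : Fin (n + 1)) :
    conj (basisPara (n := n) i) * basisPara j + conj (basisPara j) * basisPara i
      = (if i = j then (2 : ℝ) else 0) • 1 := by
  rw [basisPara_eq, basisPara_eq, conj_para_mul_para_add]
  congr 1
  by_cases h : i = j <;> simp [h]

/-- Functions killed by the Dirac operator are harmonic. -/
theorem lap_eq_zero_of_dirac (hΩ : IsOpen Ω) (hu : ContDiffOn ℝ ∞ u Ω)
    (h0 : Set.EqOn (dirac u) 0 Ω) : Set.EqOn (lap u) 0 Ω := by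
  intro x hx
  have hs := fun i => contDiffOn_pderiv hΩ hu i
  have h1 : ∀ i, ∑ j, basisPara j * pderiv i (pderiv j u) x = 0 := fun i => by
    have h := pderiv_congr hΩ h0 i hx
    rw [show dirac u = fun y => ∑ j, basisPara j * pderiv j u y from funext (dirac_eq_sum u),
      pderiv_sum fun j _ =>
        differentiableAt_of_contDiffOn hΩ (contDiffOn_mul_left _ (hs j)) hx] at h
    simp only [pderiv_mul_left _ (differentiableAt_of_contDiffOn hΩ (hs _) hx)] at h
    rw [h, pderiv]
    simp
  have h2 : ∑ i, ∑ j, (conj (basisPara i) * basisPara j) * pderiv i (pderiv j u) x = 0 :=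
    Finset.sum_eq_zero fun i _ => by simp only [mul_assoc, ← Finset.mul_sum, h1, mul_zero]
  have h3 : ∑ i, ∑ j, (conj (basisPara j) * basisPara i) * pderiv i (pderiv j u) x = 0 := by
    rw [Finset.sum_comm, ← h2]
    refine Finset.sum_congr rfl fun i _ => Finset.sum_congr rfl fun j _ => ?_
    rw [pderiv_comm hΩ hu j i hx]
  have h4 : (2 : ℝ) • lap u x
      = ∑ i, ∑ j, (conj (basisPara i) * basisPara j) * pderiv i (pderiv j u) x
        + ∑ i, ∑ j, (conj (basisPara j) * basisPara i) * pderiv i (pderiv j u) x := by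
    rw [← Finset.sum_add_distrib, lap, Finset.smul_sum]
    refine Finset.sum_congr rfl fun i _ => ?_
    rw [← Finset.sum_add_distrib]
    simp only [← add_mul, conj_basisPara_mul_add]
    simp [ite_smul]
  rw [h2, h3, add_zero] at h4
  exact (smul_eq_zero.1 h4).resolve_left two_ne_zero

/-- A function is killed by `D Δᵐ` iff itself and its product with the identity
are `(m + 1)`-harmonic. -/
theorem dirac_lapIter_eq_zero_iff (hΩ : IsOpen Ω) (hu : ContDiffOn ℝ ∞ u Ω) (m : ℕ) :
    Set.EqOn (dirac (lap^[m] u)) 0 Ω ↔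
      Polyharmonic (m + 1) u Ω ∧ Polyharmonic (m + 1) (fun y => para y * u y) Ω := by
  have hp := lapIter_para_mul hΩ hu m
  constructor
  · intro h
    have h1 : Set.EqOn (lap^[m + 1] u) 0 Ω := by
      rw [Function.iterate_succ']
      exact lap_eq_zero_of_dirac hΩ (contDiffOn_lapIter hΩ hu m) h
    refine ⟨⟨hu, h1⟩, contDiffOn_para_mul hu, fun x hx => ?_⟩
    rw [hp hx]
    simp only [h1 hx, h hx, Pi.zero_apply, mul_zero, smul_zero, add_zero]
  · rintro ⟨⟨-, h1⟩, -, h2⟩ x hx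
    have h := hp hx
    simp only [h1 hx, h2 hx, Pi.zero_apply, mul_zero, zero_add] at h
    exact (smul_eq_zero.1 h.symm).resolve_left (by positivity)

end Dirac
end Cl

namespace Cl

/-! ### Conformal linear maps and Möbius transformations -/

section Moebius

open scoped ContDiff

variable {n : ℕ}

theorem smul_one_inj {r s : ℝ} (h : r • (1 : Cl n) = s • 1) : r = s := by
  have h1 : (1 : Cl n) ∅ = 1 := by rw [← one_eq, one_apply, if_pos rfl]
  simpa [smul_apply, h1] using congrFun h ∅

theorem conj_conj (a : Cl n) : conj (conj a) = a := by
  funext A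
  rw [conj_apply, conj_apply, ← mul_assoc, mulSign_mul_self, one_mul]

theorem reverse_zero : reverse (0 : Cl n) = 0 := funext fun _ => mul_zero _

/-- A linear map into the paravectors scaling the square norm by `s` is given by
a conformal matrix. -/
theorem exists_matrix_of_isParavector (p : (Fin (n + 1) → ℝ) →ₗ[ℝ] Cl n)
    (hp : ∀ y, IsParavector (p y)) {s : ℝ} (hs : s ≠ 0)
    (h : ∀ y, p y * conj (p y) = (s * (y ⬝ᵥ y)) • 1) :
    ∃ H : Matrix (Fin (n + 1)) (Fin (n + 1)) ℝ,
      (∀ y, para (H.mulVec y) = p y) ∧ H * H.transpose = s • 1 := by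
  choose g hg using hp
  have hinj : Function.Injective (para : (Fin (n + 1) → ℝ) → Cl n) :=
    Function.LeftInverse.injective paraCoord_para
  let T : (Fin (n + 1) → ℝ) →ₗ[ℝ] (Fin (n + 1) → ℝ) :=
    { toFun := g
      map_add' := fun x y => hinj (by rw [← hg, map_add, hg, hg, para_add])
      map_smul' := fun r x => hinj (by rw [← hg, map_smul, hg, ← para_smul]; rfl) }
  have hT : ∀ y, (LinearMap.toMatrix' T).mulVec y = g y := fun y => by
    rw [LinearMap.toMatrix'_mulVec]; rfl
  have hsq : ∀ y, g y ⬝ᵥ g y = s * (y ⬝ᵥ y) := fun y =>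
    smul_one_inj (by rw [← para_mul_conj, ← hg, h])
  have hdot : ∀ x y, g x ⬝ᵥ g y = s * (x ⬝ᵥ y) := fun x y => by
    have hadd : g (x + y) = g x + g y := T.map_add x y
    have h1 := hsq (x + y)
    rw [hadd] at h1
    simp only [add_dotProduct, dotProduct_add, hsq, dotProduct_comm (g y) (g x),
      dotProduct_comm y x] at h1
    linarith
  set H := LinearMap.toMatrix' T
  have h1 : H.transpose * H = s • 1 := by
    ext i j
    have h2 : ∀ l i, H l i = g (Pi.single i 1) l := fun l i => by
      rw [← hT]; simp
    rw [Matrix.mul_apply]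
    have h3 := hdot (Pi.single i 1) (Pi.single j 1)
    rw [dotProduct] at h3
    simp only [Matrix.transpose_apply, h2, h3]
    simp [Matrix.one_apply, Pi.single_apply, eq_comm]
  refine ⟨H, fun y => by rw [hT, hg], ?_⟩
  have h2 : (s⁻¹ • H.transpose) * H = 1 := by
    rw [Matrix.smul_mul, h1, smul_smul, inv_mul_cancel₀ hs, one_smul]
  have h3 := mul_eq_one_comm.1 h2
  rw [Matrix.mul_smul] at h3
  rw [← h3, smul_smul, mul_inv_cancel₀ hs, one_smul]

/-- The inverse of a product of nonzero paravectors, and the conformal matrix it induces. -/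
theorem IsProdOfParavectors.inv_spec {c : Cl n} (hc : IsProdOfParavectors c) :
    ∃ r : ℝ, 0 < r ∧ conj c * c = r • 1 ∧ inv c = r⁻¹ • conj c ∧ c * inv c = 1 ∧ inv c * c = 1 ∧
      ∃ (H : Matrix (Fin (n + 1)) (Fin (n + 1)) ℝ) (s : ℝ),
        (∀ y, para (H.mulVec y) = reverse (inv c) * para y * inv c) ∧
        H * H.transpose = s • 1 := by
  obtain ⟨r, hr, h1, h2, h3⟩ := hc.spec
  have e1 : c * (r⁻¹ • conj c) = 1 := by
    rw [mul_smul_comm, h2, smul_smul, inv_mul_cancel₀ hr.ne', one_smul]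
  have e2 : (r⁻¹ • conj c) * c = 1 := by
    rw [smul_mul_assoc, h1, smul_smul, inv_mul_cancel₀ hr.ne', one_smul]
  have e3 : inv c = r⁻¹ • conj c := inv_eq e1 e2
  refine ⟨r, hr, h1, e3, by rw [e3, e1], by rw [e3, e2], ?_⟩
  let p : (Fin (n + 1) → ℝ) →ₗ[ℝ] Cl n :=
    { toFun := fun y => reverse (inv c) * para y * inv c
      map_add' := fun x y => by rw [para_add, mul_add, add_mul]
      map_smul' := fun t x => by
        rw [para_smul, mul_smul_comm, smul_mul_assoc]; rfl }
  have hp : ∀ y, p y = (r⁻¹ * r⁻¹) • conj (c * para (conjVec y) * reverse c) := fun y => by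
    change reverse (inv c) * para y * inv c = _
    rw [e3, conj_mul, conj_mul, conj_para, conjVec_conjVec, reverse_smul, smul_mul_assoc,
      smul_mul_assoc, mul_smul_comm, smul_smul, reverse_conj, mul_assoc]
  obtain ⟨H, hH⟩ := exists_matrix_of_isParavector p (s := r⁻¹ * r⁻¹)
    (fun y => by
      obtain ⟨z, hz⟩ := h3 (conjVec y)
      exact ⟨(r⁻¹ * r⁻¹) • conjVec z, by rw [hp, hz, conj_para, para_smul]⟩)
    (by positivity) fun y => by
      change reverse (inv c) * para y * inv c * conj (reverse (inv c) * para y * inv c) = _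
      have h4 : inv c * conj (inv c) = r⁻¹ • 1 := by
        rw [e3, conj_smul, conj_conj, mul_smul_comm, smul_mul_assoc, h1, smul_smul, smul_smul]
        congr 1
        field_simp
      have h5 : reverse (inv c) * conj (reverse (inv c)) = r⁻¹ • 1 := by
        rw [← reverse_conj, ← reverse_mul, e3, conj_smul, conj_conj, mul_smul_comm,
          smul_mul_assoc, h2, smul_smul, smul_smul, reverse_smul, reverse_one]
        congr 1
        field_simp
      have h6 : reverse (inv c) * para y * inv c * conj (reverse (inv c) * para y * inv c)
          = reverse (inv c) * (para y * (inv c * conj (inv c)) * conj (para y))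
            * conj (reverse (inv c)) := by
        rw [conj_mul, conj_mul]; simp only [mul_assoc]
      rw [h6, h4, mul_smul_comm, mul_one, smul_mul_assoc, para_mul_conj, smul_smul, mul_smul_comm,
        mul_one, smul_mul_assoc, h5, smul_smul]
      congr 1
      ring
  exact ⟨H, _, hH⟩

/-- The matrix of `conjVec`. -/
theorem diagonal_mulVec_eq_conjVec (x : Fin (n + 1) → ℝ) :
    (Matrix.diagonal (Fin.cons 1 fun _ => -1 : Fin (n + 1) → ℝ)).mulVec x = conjVec x := by
  funext i
  rw [Matrix.mulVec_diagonal]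
  refine Fin.cases ?_ (fun j => ?_) i <;> simp [conjVec]

theorem para_mul_conj_inversion {z : Fin (n + 1) → ℝ} (hz : z ≠ 0) :
    para z * conj (para (inversion z)) = 1 := by
  rw [inversion, para_smul, conj_smul, mul_smul_comm, para_mul_conj, smul_smul,
    inv_mul_cancel₀ (dot_self_pos hz).ne', one_smul]

theorem conj_inversion_mul_para {z : Fin (n + 1) → ℝ} (hz : z ≠ 0) :
    conj (para (inversion z)) * para z = 1 := by
  rw [inversion, para_smul, conj_smul, smul_mul_assoc, conj_mul_para, smul_smul,
    inv_mul_cancel₀ (dot_self_pos hz).ne', one_smul]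

theorem SAV.det_eq (M : SAV n) : M.a * reverse M.d - M.b * reverse M.c = 1 := M.det

/-- Normal form of the Möbius transformation in the case `c ≠ 0`. -/
theorem SAV.exists_of_c_ne_zero (M : SAV n) (hc : M.c ≠ 0) :
    ∃ (r s : ℝ) (H : Matrix (Fin (n + 1)) (Fin (n + 1)) ℝ) (α δ : Fin (n + 1) → ℝ),
      0 < r ∧ conj M.c * M.c = r • 1 ∧ H * H.transpose = s • 1 ∧
      (∀ x, cxd M x = M.c * para (x + δ)) ∧
      ∀ x, x + δ ≠ 0 → moebius M x = α + H.mulVec (inversion (x + δ)) ∧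
        reverse M.c * (para (moebius M x) - para α)
          = -(r⁻¹ • (conj (para (inversion (x + δ))) * conj M.c)) := by
  obtain ⟨r, hr, h1, e1, e2, e3, H, s, hH, hs⟩ := (M.prod_c.resolve_left hc).inv_spec
  obtain ⟨⟨α, hα⟩, δ, hδ⟩ := M.cond_c hc
  rw [mul_eq] at hα hδ
  set J := Matrix.diagonal (Fin.cons 1 fun _ => -1 : Fin (n + 1) → ℝ) with hJ
  have hJJ : J * J.transpose = 1 := by
    rw [hJ, Matrix.diagonal_transpose, Matrix.diagonal_mul_diagonal, ← Matrix.diagonal_one]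
    congr 1
    funext i
    refine Fin.cases ?_ (fun j => ?_) i <;> simp
  have ha : M.a = para α * M.c := by rw [← hα, mul_assoc, e3, mul_one]
  have hd : M.d = M.c * para δ := by rw [← hδ, ← mul_assoc, e2, one_mul]
  have e4 : reverse M.c * reverse (inv M.c) = 1 := by rw [← reverse_mul, e3, reverse_one]
  have hb : M.b = para α * (M.c * para δ) - reverse (inv M.c) := by
    have h : (M.a * reverse M.d - M.b * reverse M.c) * reverse (inv M.c)
        = 1 * reverse (inv M.c) := by rw [M.det_eq]
    rw [ha, hd, reverse_mul, reverse_para, sub_mul, one_mul, mul_assoc M.b, e4, mul_one,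
      mul_assoc (para α * M.c), mul_assoc (para δ), e4, mul_one] at h
    rw [← h, mul_assoc]
    abel
  have hcxd : ∀ x, cxd M x = M.c * para (x + δ) := fun x => by
    rw [para_add, mul_add, ← hd]; rfl
  have hm : ∀ x, x + δ ≠ 0 → moebius M x = α + (-(H * J)).mulVec (inversion (x + δ)) :=
      fun x hx => by
    have hinv : inv (cxd M x) = conj (para (inversion (x + δ))) * inv M.c := by
      rw [hcxd]
      refine inv_eq ?_ ?_
      · rw [mul_assoc, ← mul_assoc (para _), para_mul_conj_inversion hx, one_mul, e2]
      · rw [mul_assoc, ← mul_assoc (inv M.c), e3, one_mul, conj_inversion_mul_para hx]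
    have haxb : axb M x = para α * (M.c * para (x + δ)) - reverse (inv M.c) := by
      change M.a * para x + M.b = _
      rw [ha, hb, para_add, mul_add, mul_add, mul_assoc]
      abel
    have hcl : moebiusCl M x = para (α + (-(H * J)).mulVec (inversion (x + δ))) := by
      change axb M x * inv (cxd M x) = _
      rw [haxb, hinv, sub_mul, Matrix.neg_mulVec, ← sub_eq_add_neg, para_sub,
        ← Matrix.mulVec_mulVec, hH, diagonal_mulVec_eq_conjVec, ← conj_para]
      congr 1
      · rw [mul_assoc, mul_assoc M.c, ← mul_assoc (para (x + δ)), para_mul_conj_inversion hx,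
          one_mul, e2, mul_one]
      · rw [mul_assoc]
    rw [moebius, hcl, paraCoord_para]
  refine ⟨r, s, -(H * J), α, δ, hr, h1, ?_, hcxd, fun x hx => ⟨hm x hx, ?_⟩⟩
  · rw [Matrix.transpose_neg, neg_mul_neg, Matrix.transpose_mul, Matrix.mul_assoc,
      ← Matrix.mul_assoc J, hJJ, Matrix.one_mul, hs]
  · rw [hm x hx, para_add, add_sub_cancel_left, Matrix.neg_mulVec, ← zero_sub, para_sub, para_zero,
      zero_sub, ← Matrix.mulVec_mulVec, hH, diagonal_mulVec_eq_conjVec, ← conj_para, mul_neg,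
      ← mul_assoc, ← mul_assoc, e4, one_mul, e1, mul_smul_comm]

/-- Normal form of the Möbius transformation in the case `c = 0`. -/
theorem SAV.exists_of_c_eq_zero (M : SAV n) (hc : M.c = 0) :
    ∃ (r s : ℝ) (H : Matrix (Fin (n + 1)) (Fin (n + 1)) ℝ) (β : Fin (n + 1) → ℝ),
      H * H.transpose = s • 1 ∧ (∀ x, cxd M x = M.d) ∧
      ∀ x, moebius M x = β + H.mulVec x ∧
        para x * conj M.d = r • (reverse M.d * (para (moebius M x) - para β)) := by
  have hdet : M.a * reverse M.d = 1 := by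
    have h := M.det_eq
    rwa [hc, reverse_zero, mul_zero, sub_zero] at h
  have hd : M.d ≠ 0 := fun h => by
    rw [h, reverse_zero, mul_zero] at hdet
    have := smul_one_inj (n := n) (r := 0) (s := 1) (by rw [zero_smul, one_smul, hdet])
    exact zero_ne_one this
  obtain ⟨r, hr, h1, e1, e2, e3, H, s, hH, hs⟩ := (M.prod_d.resolve_left hd).inv_spec
  obtain ⟨β, hβ⟩ := M.cond_c0 hc
  rw [mul_eq] at hβ
  have e4 : reverse M.d * reverse (inv M.d) = 1 := by rw [← reverse_mul, e3, reverse_one]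
  have ha : M.a = reverse (inv M.d) := by
    rw [← mul_one M.a, ← e4, ← mul_assoc, hdet, one_mul]
  have hcxd : ∀ x, cxd M x = M.d := fun x => by
    change M.c * para x + M.d = _
    rw [hc, zero_mul, zero_add]
  have hm : ∀ x, moebius M x = β + H.mulVec x := fun x => by
    have hcl : moebiusCl M x = para (β + H.mulVec x) := by
      change (M.a * para x + M.b) * inv (cxd M x) = _
      rw [hcxd, para_add, hH, add_mul, hβ, ha, add_comm]
    rw [moebius, hcl, paraCoord_para]
  refine ⟨r, s, H, β, hs, hcxd, fun x => ⟨hm x, ?_⟩⟩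
  rw [hm, para_add, add_sub_cancel_left, hH, ← mul_assoc, ← mul_assoc, e4, one_mul, e1,
    mul_smul_comm, smul_smul, mul_inv_cancel₀ hr.ne', one_smul]

end Moebius
end Cl

namespace Cl

/-! ### Invariance -/

section Invariance

open scoped ContDiff

variable {n m : ℕ} {U V : Set (Fin (n + 1) → ℝ)} {f : (Fin (n + 1) → ℝ) → Cl n}

theorem dirac_lapIter_eq_zero_of_eqOn {F G₁ G₂ : (Fin (n + 1) → ℝ) → Cl n} (hU : IsOpen U)
    (h₁ : Polyharmonic (m + 1) G₁ U) (h₂ : Polyharmonic (m + 1) G₂ U) (a b c : Cl n)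
    (hF : Set.EqOn F (fun x => a * G₂ x) U)
    (hXF : Set.EqOn (fun x => para x * F x) (fun x => b * G₁ x + c * G₂ x) U) :
    Set.EqOn (dirac (lap^[m] F)) 0 U := by
  have h := (h₂.mul_left hU a).congr hU hF
  exact (dirac_lapIter_eq_zero_iff hU h.1 m).2
    ⟨h, ((h₁.mul_left hU b).add (h₂.mul_left hU c) hU).congr hU hXF⟩

theorem polyharmonic_para_sub_mul (hV : IsOpen V) {M : ℕ} (α : Fin (n + 1) → ℝ)
    (h₁ : Polyharmonic M f V) (h₂ : Polyharmonic M (fun y => para y * f y) V) :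
    Polyharmonic M (fun y => (para y - para α) * f y) V :=
  (h₂.add (h₁.mul_left hV (-para α)) hV).congr hV fun y _ => by
    simp only [sub_mul, neg_mul, ← sub_eq_add_neg]

theorem inv_norm_zpow {a : Cl n} {ρ : ℝ} (hρ : 0 < ρ) (h : conj a * a = ρ • 1) (m : ℕ) :
    (norm a ^ ((n : ℤ) + 1 - ((2 * m : ℕ) : ℤ)))⁻¹ = ρ ^ ((m : ℝ) - ((n + 1 : ℕ) : ℝ) / 2) := by
  rw [norm_eq_sqrt h, ← zpow_neg, ← Real.rpow_intCast, Real.sqrt_eq_rpow, ← Real.rpow_mul hρ.le]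
  congr 1
  push_cast
  ring

theorem SAV.dirac_lapIter_eq_zero (M : SAV n) (hU : IsOpen U)
    (hinv : ∀ x ∈ U, IsInvertible (cxd M x)) (hV : IsOpen V) (hUV : ∀ x ∈ U, moebius M x ∈ V)
    (h₁ : Polyharmonic (m + 1) f V) (h₂ : Polyharmonic (m + 1) (fun y => para y * f y) V) :
    Set.EqOn (dirac (lap^[m] fun y => (norm (cxd M y) ^ ((n : ℤ) + 1 - ((2 * m : ℕ) : ℤ)))⁻¹ •
      (conj (cxd M y) * f (moebius M y)))) 0 U := by
  by_cases hc : M.c = 0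
  · obtain ⟨r, s, H, β, hs, hcxd, hm⟩ := M.exists_of_c_eq_zero hc
    have hsub : U ⊆ (fun x => β + H.mulVec x) ⁻¹' V := fun x hx => by
      simpa only [Set.mem_preimage, ← (hm x).1] using hUV x hx
    set N := (norm M.d ^ ((n : ℤ) + 1 - ((2 * m : ℕ) : ℤ)))⁻¹
    refine dirac_lapIter_eq_zero_of_eqOn hU
      (((polyharmonic_para_sub_mul hV β h₁ h₂).comp_affine hV hs β).mono hsub)
      ((h₁.comp_affine hV hs β).mono hsub) (N • conj M.d) ((N * r) • reverse M.d) 0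
      (fun x _ => ?_) fun x _ => ?_
    · simp only [hcxd, ← (hm x).1, smul_mul_assoc, N]
    · simp only [hcxd, ← (hm x).1, zero_mul, add_zero, mul_smul_comm, ← mul_assoc, smul_mul_assoc,
        (hm x).2, smul_smul, N]
  · obtain ⟨r, s, H, α, δ, hr, hcc, hs, hcxd, hm⟩ := M.exists_of_c_ne_zero hc
    have hz : ∀ x ∈ U, x + δ ≠ 0 := fun x hx h => by
      obtain ⟨b, hb, -⟩ := hinv x hx
      rw [mul_eq, one_eq, hcxd, h, para_zero, mul_zero, zero_mul] at hb
      have := smul_one_inj (n := n) (r := 0) (s := 1) (by rw [zero_smul, one_smul, hb])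
      exact zero_ne_one this
    have hsub : U ⊆ {x | x + δ ≠ 0 ∧ α + H.mulVec (inversion (x + δ)) ∈ V} := fun x hx =>
      ⟨hz x hx, by rw [← (hm x (hz x hx)).1]; exact hUV x hx⟩
    obtain ⟨t, ht⟩ : ∃ t : ℝ, t = (m : ℝ) - ((n + 1 : ℕ) : ℝ) / 2 := ⟨_, rfl⟩
    have hN : ∀ x ∈ U, (norm (cxd M x) ^ ((n : ℤ) + 1 - ((2 * m : ℕ) : ℤ)))⁻¹
        = r ^ t * ((x + δ) ⬝ᵥ (x + δ)) ^ t := fun x hx => by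
      have hq := dot_self_pos (hz x hx)
      rw [← Real.mul_rpow hr.le hq.le, ht]
      refine inv_norm_zpow (by positivity) ?_ m
      rw [hcxd, conj_mul, mul_assoc, ← mul_assoc (conj M.c), hcc, smul_mul_assoc, one_mul,
        mul_smul_comm, conj_mul_para, smul_smul]
    have hw : (((m + 1 : ℕ) : ℝ) - ((n + 1 : ℕ) : ℝ) / 2) = t + 1 := by
      rw [ht]; push_cast; ring
    have hconj : ∀ x ∈ U, conj (cxd M x) = -(((x + δ) ⬝ᵥ (x + δ)) * r) •
        (reverse M.c * (para (moebius M x) - para α)) := fun x hx => by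
      have hq := dot_self_pos (hz x hx)
      rw [(hm x (hz x hx)).2, hcxd, conj_mul, inversion, para_smul, conj_smul, smul_mul_assoc,
        smul_smul, neg_smul_neg, smul_smul]
      rw [show (x + δ) ⬝ᵥ (x + δ) * r * (r⁻¹ * ((x + δ) ⬝ᵥ (x + δ))⁻¹) = 1 by field_simp, one_smul]
    have hF : Set.EqOn (fun y => (norm (cxd M y) ^ ((n : ℤ) + 1 - ((2 * m : ℕ) : ℤ)))⁻¹ •
          (conj (cxd M y) * f (moebius M y)))
        (fun x => ((-(r ^ t * r)) • reverse M.c) * (((x + δ) ⬝ᵥ (x + δ)) ^ (t + 1) •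
          ((para (α + H.mulVec (inversion (x + δ))) - para α) *
            f (α + H.mulVec (inversion (x + δ)))))) U := fun x hx => by
      have hq := dot_self_pos (hz x hx)
      simp only []
      rw [← (hm x (hz x hx)).1, hN x hx, hconj x hx, Real.rpow_add_one hq.ne', smul_mul_assoc,
        smul_mul_assoc, mul_smul_comm, smul_smul, smul_smul, mul_assoc (reverse M.c)]
      congr 1
      ring
    have hT₁ := (h₁.comp_inversion hV hs α δ).mono hsub
    have hT₂ := ((polyharmonic_para_sub_mul hV α h₁ h₂).comp_inversion hV hs α δ).mono hsub
    rw [hw] at hT₁ hT₂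
    refine dirac_lapIter_eq_zero_of_eqOn hU hT₁ hT₂ _ (r ^ t • conj M.c)
      (-(para δ * ((-(r ^ t * r)) • reverse M.c))) hF fun x hx => ?_
    have hq := dot_self_pos (hz x hx)
    have hx' : para x = para (x + δ) - para δ := by rw [← para_sub, add_sub_cancel_right]
    have hx2 := hF hx
    simp only [] at hx2 ⊢
    rw [neg_mul, mul_assoc (para δ), ← hx2, ← sub_eq_add_neg, hx', sub_mul]
    congr 1
    rw [← (hm x (hz x hx)).1, hN x hx, hcxd, conj_mul, mul_smul_comm, mul_smul_comm,
      smul_mul_assoc, smul_smul, mul_assoc (conj (para _)), ← mul_assoc (para _), para_mul_conj,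
      smul_mul_assoc, one_mul, smul_smul, Real.rpow_add_one hq.ne']
    congr 1
    ring

end Invariance
end Cl

/-- Quasi-invariance of `k`-holomorphic Cliffordian functions under Möbius transformations
induced by matrices of `SAV(ℝ ⊕ ℝⁿ)`. -/
theorem kHolomorphicCliffordian_moebius_invariance
    (n : ℕ) (hn : 1 ≤ n) (k : ℕ) (hk : Even k)
    (M : Cl.SAV n)
    (U : Set (Fin (n + 1) → ℝ)) (hU : IsOpen U)
    (hinv : ∀ x ∈ U, Cl.IsInvertible (Cl.cxd M x))
    (V : Set (Fin (n + 1) → ℝ)) (hV : IsOpen V)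
    (hUV : ∀ x ∈ U, Cl.moebius M x ∈ V)
    (f : (Fin (n + 1) → ℝ) → Cl n)
    (hf : ContDiffOn ℝ (⊤ : ℕ∞) f V)
    (hf0 : ∀ y ∈ V, Cl.dirac ((Cl.lap)^[k / 2] f) y = 0)
    (F : (Fin (n + 1) → ℝ) → Cl n)
    (hF : F = fun y => (Cl.norm (Cl.cxd M y) ^ ((n : ℤ) + 1 - (k : ℤ)))⁻¹ •
      Cl.mul (Cl.conj (Cl.cxd M y)) (f (Cl.moebius M y))) :
    ∀ x ∈ U, Cl.dirac ((Cl.lap)^[k / 2] F) x = 0 := by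
  obtain ⟨m, rfl⟩ := hk.two_dvd
  rw [Nat.mul_div_cancel_left m two_pos] at hf0 ⊢
  obtain ⟨h₁, h₂⟩ := (Cl.dirac_lapIter_eq_zero_iff hV hf m).1 hf0
  rw [hF]
  exact M.dirac_lapIter_eq_zero hU hinv hV hUV h₁ h₂
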